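/- arXiv:1501.07876 — 4 statements merged into one kernel-verified Lean document; each statement's English description precedes it below -/
import Mathlib

section
/- Let g : ℝ → ℝ be a 2π-periodic, twice continuously differentiable function, and let ĝ_m = (1/2π)∫₀^{2π} e^{−imθ} g(θ) dθ denote its Fourier coefficients. For φ ∈ D_X the series (A_g φ)_k := Σ_{m∈ℤ} ĝ_m·(k − m/2)·φ_{k−m} converges absolutely for every k ∈ ℤ and defines an element A_g φ ∈ ℓ²(ℤ). The densely defined operator A_g with domain D_X is symmetric and essentially self-adjoint (its closure is self-adjoint). Moreover there exists c > 0 such that ‖A_g φ‖² ≤ c·(‖φ‖² + ‖Xφ‖²) for all φ ∈ D_X, and for every φ with Σ_k (1+k²)²|φ_k|² < ∞ one has A_g φ ∈ D_X with ‖A_g(A_g φ)‖² ≤ c·(‖φ‖² + ‖X²φ‖²). -/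
open scoped ComplexInnerProductSpace

noncomputable section

/-- `ℓ²(ℤ)`. -/
abbrev l2Z : Type := lp (fun _ : ℤ => ℂ) 2

/-- The Fourier coefficients `ĝ_m = (1/2π)∫₀^{2π} e^{−imθ} g(θ) dθ` of `g`. -/
noncomputable def fcoef (g : ℝ → ℝ) (m : ℤ) : ℂ :=
  (2 * (Real.pi : ℂ))⁻¹ *
    ∫ θ in (0 : ℝ)..(2 * Real.pi),
      Complex.exp (-(m : ℂ) * Complex.I * (θ : ℂ)) * (g θ : ℂ)

/-- Membership in `D_X`: `Σ_k (1+k²)|φ_k|² < ∞`. -/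
def memDX (φ : ℤ → ℂ) : Prop :=
  Summable fun k : ℤ => (1 + (k : ℝ) ^ 2) * ‖φ k‖ ^ 2

/-- The formal action of the conjugate operator
`A_g = ½(L_g X + X L_g)`: `(A_g φ)_k = Σ_m ĝ_m·(k − m/2)·φ_{k−m}`. -/
noncomputable def agFun (g : ℝ → ℝ) (f : ℤ → ℂ) (k : ℤ) : ℂ :=
  ∑' m : ℤ, fcoef g m * ((k : ℂ) - (m : ℂ) / 2) * f (k - m)

/-- Cauchy–Schwarz for nonnegative series. -/
lemma summable_mul_and_sq_tsum_mul_le {ι : Type*} {f g : ι → ℝ} (hf : ∀ i, 0 ≤ f i)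
    (hg : ∀ i, 0 ≤ g i) (hfs : Summable fun i => f i ^ 2) (hgs : Summable fun i => g i ^ 2) :
    (Summable fun i => f i * g i) ∧
      (∑' i, f i * g i) ^ 2 ≤ (∑' i, f i ^ 2) * ∑' i, g i ^ 2 := by
  obtain ⟨h1, h2⟩ := Real.summable_and_inner_le_Lp_mul_Lq_tsum_of_nonneg
    Real.HolderConjugate.two_two hf hg (by simpa using hfs) (by simpa using hgs)
  refine ⟨h1, ?_⟩
  simp only [Real.rpow_two, ← Real.sqrt_eq_rpow] at h2
  have h0 : 0 ≤ ∑' i, f i * g i := tsum_nonneg fun i => mul_nonneg (hf i) (hg i)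
  calc (∑' i, f i * g i) ^ 2 ≤ (√(∑' i, f i ^ 2) * √(∑' i, g i ^ 2)) ^ 2 := by gcongr
    _ = _ := by
      rw [mul_pow, Real.sq_sqrt (tsum_nonneg fun i => sq_nonneg _),
        Real.sq_sqrt (tsum_nonneg fun i => sq_nonneg _)]

/-- Young's inequality `ℓ¹ * ℓ² ⊆ ℓ²` on `ℤ`, for nonnegative sequences. -/
lemma young_l1_l2 {b f : ℤ → ℝ} (hb : ∀ i, 0 ≤ b i) (hf : ∀ i, 0 ≤ f i)
    (hbs : Summable b) (hfs : Summable fun i => f i ^ 2) :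
    (∀ k, Summable fun m => b m * f (k - m)) ∧
      (Summable fun k => (∑' m, b m * f (k - m)) ^ 2) ∧
      ∑' k, (∑' m, b m * f (k - m)) ^ 2 ≤ (∑' m, b m) ^ 2 * ∑' j, f j ^ 2 := by
  let e : ℤ × ℤ ≃ ℤ × ℤ :=
    { toFun := fun p => (p.2, p.1 - p.2)
      invFun := fun p => (p.1 + p.2, p.1)
      left_inv := fun p => by simp
      right_inv := fun p => by simp }
  have hprod : HasSum (fun p : ℤ × ℤ => b p.1 * f p.2 ^ 2) ((∑' m, b m) * ∑' j, f j ^ 2) :=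
    HasSum.mul (f := b) (g := fun j => f j ^ 2) hbs.hasSum hfs.hasSum
      (hbs.mul_of_nonneg hfs hb fun j => sq_nonneg _)
  have hprod' : HasSum (fun p : ℤ × ℤ => b p.2 * f (p.1 - p.2) ^ 2)
      ((∑' m, b m) * ∑' j, f j ^ 2) := (e.hasSum_iff).2 hprod
  have hfib : ∀ k, Summable fun m => b m * f (k - m) ^ 2 := fun k =>
    hprod'.summable.prod_factor k
  have hsum : HasSum (fun k => ∑' m, b m * f (k - m) ^ 2) ((∑' m, b m) * ∑' j, f j ^ 2) :=
    hprod'.prod_fiberwise fun k => (hfib k).hasSum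
  have key : ∀ k, (Summable fun m => b m * f (k - m)) ∧
      (∑' m, b m * f (k - m)) ^ 2 ≤ (∑' m, b m) * ∑' m, b m * f (k - m) ^ 2 := by
    intro k
    have hs : ∀ m, √(b m) ^ 2 = b m := fun m => Real.sq_sqrt (hb m)
    have h1 : ∀ m, (√(b m) * f (k - m)) ^ 2 = b m * f (k - m) ^ 2 := fun m => by
      rw [mul_pow, hs]
    have h2 : ∀ m, √(b m) * (√(b m) * f (k - m)) = b m * f (k - m) := fun m => by
      rw [← mul_assoc, ← sq, hs]
    have := summable_mul_and_sq_tsum_mul_le (f := fun m => √(b m))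
      (g := fun m => √(b m) * f (k - m)) (fun m => Real.sqrt_nonneg _)
      (fun m => mul_nonneg (Real.sqrt_nonneg _) (hf _)) (by simpa only [hs] using hbs)
      (by simpa only [h1] using hfib k)
    simpa only [h1, h2, hs] using this
  have hbig := hsum.summable.mul_left (∑' m, b m)
  have hsq : Summable fun k => (∑' m, b m * f (k - m)) ^ 2 :=
    hbig.of_nonneg_of_le (fun k => sq_nonneg _) fun k => (key k).2
  refine ⟨fun k => (key k).1, hsq, ?_⟩
  calc ∑' k, (∑' m, b m * f (k - m)) ^ 2
      ≤ ∑' k, (∑' m, b m) * ∑' m, b m * f (k - m) ^ 2 :=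
        hsq.tsum_le_tsum (fun k => (key k).2) hbig
    _ = _ := by rw [tsum_mul_left, hsum.tsum_eq]; ring

lemma summable_one_add_abs_inv_sq : Summable fun m : ℤ => ((1 + |(m : ℝ)|)⁻¹) ^ 2 := by
  refine Summable.of_norm_bounded_eventually
    (Real.summable_one_div_int_pow.mpr (le_refl 2)) ?_
  filter_upwards [(Set.finite_singleton (0 : ℤ)).compl_mem_cofinite] with m hm
  have hm : (m : ℝ) ≠ 0 := by simpa using hm
  rw [Real.norm_of_nonneg (by positivity), inv_pow, one_div, ← sq_abs (m : ℝ)]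
  have := abs_pos.2 hm
  gcongr
  linarith

/-- A sequence with `(1+|m|) f_m` square-summable is summable. -/
lemma summable_of_weighted_sq {f : ℤ → ℝ} (hf : ∀ m, 0 ≤ f m)
    (hs : Summable fun m : ℤ => ((1 + |(m : ℝ)|) * f m) ^ 2) :
    Summable f ∧ (∑' m, f m) ^ 2 ≤
      (∑' m : ℤ, ((1 + |(m : ℝ)|)⁻¹) ^ 2) * ∑' m : ℤ, ((1 + |(m : ℝ)|) * f m) ^ 2 := by
  have := summable_mul_and_sq_tsum_mul_le (fun m : ℤ => by positivity)
    (fun m => mul_nonneg (by positivity) (hf m)) summable_one_add_abs_inv_sq hs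
  have h2 : ∀ m : ℤ, (1 + |(m : ℝ)|)⁻¹ * ((1 + |(m : ℝ)|) * f m) = f m := fun m => by
    rw [inv_mul_cancel_left₀ (by positivity)]
  simpa only [h2] using this

lemma one_add_abs_sq_le (x : ℝ) : (1 + |x|) ^ 2 ≤ 2 * (1 + x ^ 2) := by
  nlinarith [sq_nonneg (1 - |x|), sq_abs x]

lemma one_add_sq_le (x : ℝ) : 1 + x ^ 2 ≤ (1 + |x|) ^ 2 := by
  nlinarith [abs_nonneg x, sq_abs x]

lemma memDX_iff {f : ℤ → ℂ} :
    memDX f ↔ Summable fun k : ℤ => ((1 + |(k : ℝ)|) * ‖f k‖) ^ 2 := by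
  simp only [mul_pow]
  constructor <;> intro h
  · refine (h.mul_left 2).of_nonneg_of_le (fun k => by positivity) fun k => ?_
    rw [← mul_assoc]
    gcongr
    exact one_add_abs_sq_le _
  · refine h.of_nonneg_of_le (fun k => by positivity) fun k => ?_
    gcongr
    exact one_add_sq_le _

lemma l2Z_summable_sq (φ : l2Z) : Summable fun k => ‖φ k‖ ^ 2 := by
  simpa using (lp.memℓp φ).summable (by simp)

lemma l2Z_norm_sq (φ : l2Z) : ‖φ‖ ^ 2 = ∑' k, ‖φ k‖ ^ 2 := by
  simpa using lp.norm_rpow_eq_tsum (p := 2) (by simp) φ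

lemma memℓp_two_of_summable_sq {f : ℤ → ℂ} (h : Summable fun k => ‖f k‖ ^ 2) : Memℓp f 2 :=
  memℓp_gen (by simpa using h)

open LinearPMap in
/-- A densely defined symmetric operator is essentially self-adjoint once the graph of its adjoint
lies in the closure of its graph. -/
lemma essentiallySelfAdjoint_of_adjoint_graph_le {E : Type*} [NormedAddCommGroup E]
    [InnerProductSpace ℂ E] [CompleteSpace E] {A : E →ₗ.[ℂ] E} (hd : Dense (A.domain : Set E))
    (hs : A.IsFormalAdjoint A)
    (h : A†.graph ≤ A.graph.topologicalClosure) :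
    A.IsClosable ∧ A.closure† = A.closure := by
  have hle : A ≤ A† := hs.le_adjoint hd
  have hcl : A†.IsClosed := adjoint_isClosed hd
  have hc : A.IsClosable := hcl.isClosable.leIsClosable hle
  have hg := hc.graph_closure_eq_closure_graph
  have heq : A.closure = A† := by
    refine le_antisymm (le_of_le_graph ?_) (le_of_le_graph ?_)
    · rw [← hg]
      exact Submodule.topologicalClosure_minimal _ (le_graph_of_le hle) hcl
    · rwa [← hg]
  have hd' : Dense (A.closure.domain : Set E) := hd.mono A.le_closure.1
  refine ⟨hc, le_antisymm ?_ ?_⟩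
  · refine le_trans (le_of_le_graph ?_) heq.ge
    rw [adjoint_graph_eq_graph_adjoint hd', adjoint_graph_eq_graph_adjoint hd]
    intro x hx
    rw [Submodule.mem_adjoint_iff] at hx ⊢
    exact fun a b hab => hx a b (le_graph_of_le A.le_closure hab)
  · refine IsFormalAdjoint.le_adjoint hd' ?_
    intro x y
    have hy : (y : E) ∈ A†.domain := heq ▸ y.2
    have hyv : A† ⟨y, hy⟩ = A.closure y := (heq.ge.2 rfl)
    have hclosed : IsClosed {p : E × E | inner ℂ p.2 (y : E) = inner ℂ p.1 (A.closure y)} :=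
      isClosed_eq (by fun_prop) (by fun_prop)
    have hx : ((x : E), A.closure x) ∈ A.graph.topologicalClosure := by
      rw [hg]; exact A.closure.mem_graph x
    refine closure_minimal (s := (A.graph : Set (E × E))) ?_ hclosed hx
    rintro ⟨a, b⟩ hab
    obtain ⟨z, rfl, rfl⟩ := (mem_graph_iff _).1 hab
    have := (adjoint_isFormalAdjoint hd).symm z ⟨y, hy⟩
    rwa [hyv] at this

lemma fcoef_eq_fourierCoeffOn (g : ℝ → ℝ) (m : ℤ) :
    fcoef g m = fourierCoeffOn Real.two_pi_pos (fun θ => (g θ : ℂ)) m := by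
  rw [fourierCoeffOn_eq_integral, fcoef, Complex.real_smul]
  congr 1
  · push_cast; rw [sub_zero, one_div]
  · refine intervalIntegral.integral_congr fun θ _ => ?_
    simp only [smul_eq_mul]
    congr 2
    push_cast
    have : (Real.pi : ℂ) ≠ 0 := by exact_mod_cast Real.pi_ne_zero
    field_simp
    simp
    ring

lemma fcoef_neg (g : ℝ → ℝ) (m : ℤ) : fcoef g (-m) = starRingEnd ℂ (fcoef g m) := by
  rw [fcoef, fcoef, map_mul, ← intervalIntegral.intervalIntegral_conj]
  congr 1
  · simp [map_ofNat (starRingEnd ℂ) 2]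
  · refine intervalIntegral.integral_congr fun θ _ => ?_
    simp [← Complex.exp_conj]

/-- Integration by parts for Fourier coefficients of a periodic `C¹` function. -/
lemma abs_mul_norm_fcoef {g : ℝ → ℝ} (hper : ∀ θ : ℝ, g (θ + 2 * Real.pi) = g θ)
    (hreg : ContDiff ℝ 1 g) (m : ℤ) :
    |(m : ℝ)| * ‖fcoef g m‖ ≤ ‖fcoef (deriv g) m‖ := by
  rcases eq_or_ne m 0 with rfl | hm
  · simp
  have hm' : |(m : ℝ)| ≠ 0 := by simpa using hm
  have hd : ∀ x, HasDerivAt (fun θ => (g θ : ℂ)) ((deriv g x : ℝ) : ℂ) x := fun x =>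
    ((hreg.differentiable (by simp)) x).hasDerivAt.ofReal_comp
  have hc : Continuous fun x => ((deriv g x : ℝ) : ℂ) :=
    Complex.continuous_ofReal.comp (hreg.continuous_deriv le_rfl)
  have hp : g (2 * Real.pi) = g 0 := by simpa using hper 0
  rw [fcoef_eq_fourierCoeffOn, fcoef_eq_fourierCoeffOn,
    fourierCoeffOn_of_hasDerivAt Real.two_pi_pos hm (fun x _ => hd x) (hc.intervalIntegrable _ _)]
  simp only [hp, sub_self, mul_zero, zero_sub, norm_mul, norm_neg, norm_div, Complex.ofReal_zero,
    sub_zero, norm_one, Complex.norm_I, Complex.norm_real, Complex.norm_intCast]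
  have hpi : ‖(2 : ℂ) * Real.pi‖ ≠ 0 := by simp [Real.pi_ne_zero]
  have : ‖Real.pi‖ ≠ 0 := by simp [Real.pi_ne_zero]
  apply le_of_eq
  simp
  field_simp

/-- The weighted square-summability of the Fourier coefficients of a periodic `C²` function. -/
lemma summable_weighted_fcoef {g : ℝ → ℝ} (hper : ∀ θ : ℝ, g (θ + 2 * Real.pi) = g θ)
    (hreg : ContDiff ℝ 2 g) :
    Summable fun m : ℤ => ((1 + |(m : ℝ)|) ^ 2 * ‖fcoef g m‖) ^ 2 := by
  have hreg1 : ContDiff ℝ 1 (deriv g) :=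
    (contDiff_succ_iff_deriv (n := 1).1 (by simpa [one_add_one_eq_two] using hreg)).2.2
  have hper1 : ∀ θ : ℝ, deriv g (θ + 2 * Real.pi) = deriv g θ := fun θ => by
    rw [← deriv_comp_add_const]
    exact congrArg (fun f => deriv f θ) (funext hper)
  have hc : Continuous fun x => ((deriv (deriv g) x : ℝ) : ℂ) :=
    Complex.continuous_ofReal.comp (hreg1.continuous_deriv le_rfl)
  have hL2 : MeasureTheory.MemLp (fun x => ((deriv (deriv g) x : ℝ) : ℂ)) 2
      (MeasureTheory.volume.restrict (Set.Ioc 0 (2 * Real.pi))) := by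
    obtain ⟨C, hC⟩ := (isCompact_Icc (a := 0) (b := 2 * Real.pi)).exists_bound_of_continuousOn
      hc.continuousOn
    refine MeasureTheory.MemLp.of_bound hc.aestronglyMeasurable C ?_
    filter_upwards [MeasureTheory.ae_restrict_mem measurableSet_Ioc] with x hx
    exact hC x (Set.Ioc_subset_Icc_self hx)
  have hs := (hasSum_sq_fourierCoeffOn Real.two_pi_pos hL2).summable
  simp only [← fcoef_eq_fourierCoeffOn] at hs
  refine Summable.of_norm_bounded_eventually (hs.mul_left 16) ?_
  filter_upwards [(Set.finite_singleton (0 : ℤ)).compl_mem_cofinite] with m hm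
  have hm : m ≠ 0 := by simpa using hm
  have hm1 : 1 ≤ |(m : ℝ)| := by exact_mod_cast Int.one_le_abs hm
  have h2 : |(m : ℝ)| ^ 2 * ‖fcoef g m‖ ≤ ‖fcoef (deriv (deriv g)) m‖ :=
    calc |(m : ℝ)| ^ 2 * ‖fcoef g m‖ = |(m : ℝ)| * (|(m : ℝ)| * ‖fcoef g m‖) := by ring
      _ ≤ |(m : ℝ)| * ‖fcoef (deriv g) m‖ := by
        gcongr
        exact abs_mul_norm_fcoef hper (hreg.of_le (by norm_num)) m
      _ ≤ _ := abs_mul_norm_fcoef hper1 hreg1 m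
  rw [Real.norm_of_nonneg (by positivity)]
  calc ((1 + |(m : ℝ)|) ^ 2 * ‖fcoef g m‖) ^ 2
      ≤ ((2 * |(m : ℝ)|) ^ 2 * ‖fcoef g m‖) ^ 2 := by gcongr; linarith
    _ = 16 * (|(m : ℝ)| ^ 2 * ‖fcoef g m‖) ^ 2 := by ring
    _ ≤ _ := by gcongr

lemma summable_one_add_abs_mul_fcoef {g : ℝ → ℝ}
    (hF : Summable fun m : ℤ => ((1 + |(m : ℝ)|) ^ 2 * ‖fcoef g m‖) ^ 2) :
    Summable fun m : ℤ => (1 + |(m : ℝ)|) * ‖fcoef g m‖ :=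
  (summable_of_weighted_sq (fun m => by positivity)
    (hF.congr fun m => by rw [sq (1 + |(m : ℝ)|), mul_assoc])).1

lemma norm_sub_half_le (k m : ℤ) :
    ‖(k : ℂ) - (m : ℂ) / 2‖ ≤ |((k - m : ℤ) : ℝ)| + |(m : ℝ)| / 2 := by
  have h1 : (k : ℂ) - (m : ℂ) / 2 = ((k - m : ℤ) : ℂ) + (m : ℂ) / 2 := by push_cast; ring
  rw [h1]
  refine (norm_add_le _ _).trans ?_
  simp [Complex.norm_intCast, -Int.cast_sub]

lemma norm_agFun_term_le (g : ℝ → ℝ) (f : ℤ → ℂ) (k m : ℤ) :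
    ‖fcoef g m * ((k : ℂ) - (m : ℂ) / 2) * f (k - m)‖ ≤
      ((1 + |(m : ℝ)|) * ‖fcoef g m‖) * ((1 + |((k - m : ℤ) : ℝ)|) * ‖f (k - m)‖) := by
  rw [norm_mul, norm_mul]
  calc ‖fcoef g m‖ * ‖(k : ℂ) - (m : ℂ) / 2‖ * ‖f (k - m)‖
      ≤ ‖fcoef g m‖ * ((1 + |(m : ℝ)|) * (1 + |((k - m : ℤ) : ℝ)|)) * ‖f (k - m)‖ := by
        gcongr
        refine (norm_sub_half_le k m).trans ?_
        nlinarith [abs_nonneg (m : ℝ), abs_nonneg ((k - m : ℤ) : ℝ),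
          mul_nonneg (abs_nonneg (m : ℝ)) (abs_nonneg ((k - m : ℤ) : ℝ))]
    _ = _ := by ring

section Bounds

variable {g : ℝ → ℝ} (hF : Summable fun m : ℤ => ((1 + |(m : ℝ)|) ^ 2 * ‖fcoef g m‖) ^ 2)

include hF

lemma summable_norm_agFun_term {f : ℤ → ℂ} (hf : memDX f) (k : ℤ) :
    Summable fun m : ℤ => ‖fcoef g m * ((k : ℂ) - (m : ℂ) / 2) * f (k - m)‖ :=
  ((young_l1_l2 (f := fun j : ℤ => (1 + |(j : ℝ)|) * ‖f j‖) (fun m => by positivity)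
    (fun j => by positivity) (summable_one_add_abs_mul_fcoef hF) (memDX_iff.1 hf)).1 k).of_nonneg_of_le
    (fun m => norm_nonneg _) (norm_agFun_term_le g f k)

lemma agFun_sq_bound {f : ℤ → ℂ} (hf : memDX f) :
    (Summable fun k => ‖agFun g f k‖ ^ 2) ∧
      ∑' k, ‖agFun g f k‖ ^ 2 ≤ (∑' m : ℤ, (1 + |(m : ℝ)|) * ‖fcoef g m‖) ^ 2 *
        ∑' j : ℤ, ((1 + |(j : ℝ)|) * ‖f j‖) ^ 2 := by
  obtain ⟨h1, h2, h3⟩ := young_l1_l2 (f := fun j : ℤ => (1 + |(j : ℝ)|) * ‖f j‖)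
    (fun m => by positivity) (fun j => by positivity)
    (summable_one_add_abs_mul_fcoef hF) (memDX_iff.1 hf)
  have hle : ∀ k, ‖agFun g f k‖ ^ 2 ≤ (∑' m : ℤ, (1 + |(m : ℝ)|) * ‖fcoef g m‖ *
      ((1 + |((k - m : ℤ) : ℝ)|) * ‖f (k - m)‖)) ^ 2 := fun k => by
    gcongr
    exact tsum_of_norm_bounded (h1 k).hasSum (norm_agFun_term_le g f k)
  have hs := h2.of_nonneg_of_le (fun k => sq_nonneg _) hle
  exact ⟨hs, (hs.tsum_le_tsum hle h2).trans h3⟩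

lemma memℓp_agFun {f : ℤ → ℂ} (hf : memDX f) : Memℓp (agFun g f) 2 :=
  memℓp_two_of_summable_sq (agFun_sq_bound hF hf).1

/-- On `D(X²)`, the sequence `X A_g f` is square-summable with a quantitative bound. -/
lemma exists_weighted_agFun_sq_bound : ∃ C : ℝ, 0 ≤ C ∧ ∀ f : ℤ → ℂ,
    (Summable fun j : ℤ => ((1 + |(j : ℝ)|) ^ 2 * ‖f j‖) ^ 2) →
      (Summable fun k : ℤ => ((1 + |(k : ℝ)|) * ‖agFun g f k‖) ^ 2) ∧
        ∑' k : ℤ, ((1 + |(k : ℝ)|) * ‖agFun g f k‖) ^ 2 ≤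
          C * ∑' j : ℤ, ((1 + |(j : ℝ)|) ^ 2 * ‖f j‖) ^ 2 := by
  set B := ∑' m : ℤ, (1 + |(m : ℝ)|) * ‖fcoef g m‖
  set D := ∑' m : ℤ, ((1 + |(m : ℝ)|)⁻¹) ^ 2
  set W := ∑' m : ℤ, ((1 + |(m : ℝ)|) ^ 2 * ‖fcoef g m‖) ^ 2
  have hD : 0 ≤ D := tsum_nonneg fun m => sq_nonneg _
  have hW : 0 ≤ W := tsum_nonneg fun m => sq_nonneg _
  refine ⟨2 * (B ^ 2 + D * W), by positivity, fun f hf => ?_⟩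
  have hmono : ∀ j : ℤ, ((1 + |(j : ℝ)|) * ‖f j‖) ^ 2 ≤ ((1 + |(j : ℝ)|) ^ 2 * ‖f j‖) ^ 2 :=
    fun j => by
      gcongr
      nlinarith [abs_nonneg (j : ℝ)]
  have hfX : Summable fun j : ℤ => ((1 + |(j : ℝ)|) * ‖f j‖) ^ 2 :=
    hf.of_nonneg_of_le (fun j => sq_nonneg _) hmono
  obtain ⟨hl1, hl1b⟩ := summable_of_weighted_sq (fun j => norm_nonneg (f j)) hfX
  obtain ⟨h1, h2, h3⟩ := young_l1_l2 (f := fun j : ℤ => (1 + |(j : ℝ)|) ^ 2 * ‖f j‖)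
    (fun m => by positivity) (fun j => by positivity)
    (summable_one_add_abs_mul_fcoef hF) hf
  obtain ⟨h1', h2', h3'⟩ := young_l1_l2 (f := fun m : ℤ => (1 + |(m : ℝ)|) ^ 2 * ‖fcoef g m‖)
    (fun j => norm_nonneg (f j)) (fun m => by positivity) hl1 hF
  set P : ℤ → ℝ := fun k => ∑' m : ℤ, (1 + |(m : ℝ)|) * ‖fcoef g m‖ *
    ((1 + |((k - m : ℤ) : ℝ)|) ^ 2 * ‖f (k - m)‖)
  set Q : ℤ → ℝ := fun k => ∑' j : ℤ, ‖f j‖ *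
    ((1 + |((k - j : ℤ) : ℝ)|) ^ 2 * ‖fcoef g (k - j)‖)
  have hQ : ∀ k, HasSum (fun m : ℤ => ‖f (k - m)‖ * ((1 + |(m : ℝ)|) ^ 2 * ‖fcoef g m‖)) (Q k) :=
    fun k => by
      have := ((Equiv.subLeft k).hasSum_iff).2 (h1' k).hasSum
      simpa only [Function.comp_def, Equiv.subLeft_apply, sub_sub_cancel] using this
  have hpt : ∀ k : ℤ, (1 + |(k : ℝ)|) * ‖agFun g f k‖ ≤ P k + Q k := fun k => by
    have hk : ‖((1 + |(k : ℝ)| : ℝ) : ℂ)‖ = 1 + |(k : ℝ)| := by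
      rw [Complex.norm_real, Real.norm_of_nonneg (by positivity)]
    rw [← hk, ← norm_mul, agFun, ← tsum_mul_left]
    refine tsum_of_norm_bounded ((h1 k).hasSum.add (hQ k)) fun m => ?_
    rw [norm_mul, hk, norm_mul, norm_mul]
    have hkm : |(k : ℝ)| ≤ |((k - m : ℤ) : ℝ)| + |(m : ℝ)| := by
      have := abs_add_le ((k - m : ℤ) : ℝ) (m : ℝ)
      simpa using this
    have hu := abs_nonneg ((k - m : ℤ) : ℝ)
    have hw := abs_nonneg (m : ℝ)
    calc (1 + |(k : ℝ)|) * (‖fcoef g m‖ * ‖(k : ℂ) - (m : ℂ) / 2‖ * ‖f (k - m)‖)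
        ≤ (1 + (|((k - m : ℤ) : ℝ)| + |(m : ℝ)|)) *
          (‖fcoef g m‖ * (|((k - m : ℤ) : ℝ)| + |(m : ℝ)| / 2) * ‖f (k - m)‖) := by
          gcongr
          exact norm_sub_half_le k m
      _ = ((1 + (|((k - m : ℤ) : ℝ)| + |(m : ℝ)|)) * (|((k - m : ℤ) : ℝ)| + |(m : ℝ)| / 2)) *
          (‖fcoef g m‖ * ‖f (k - m)‖) := by ring
      _ ≤ ((1 + |(m : ℝ)|) * (1 + |((k - m : ℤ) : ℝ)|) ^ 2 + (1 + |(m : ℝ)|) ^ 2) *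
          (‖fcoef g m‖ * ‖f (k - m)‖) := by
          gcongr
          nlinarith [mul_nonneg hu hw, mul_nonneg hw (sq_nonneg |((k - m : ℤ) : ℝ)|)]
      _ = _ := by ring
  have hpt2 : ∀ k : ℤ, ((1 + |(k : ℝ)|) * ‖agFun g f k‖) ^ 2 ≤ 2 * (P k ^ 2 + Q k ^ 2) :=
    fun k => by
      have h0 : 0 ≤ (1 + |(k : ℝ)|) * ‖agFun g f k‖ := by positivity
      nlinarith [hpt k, sq_nonneg (P k - Q k)]
  have hbig : Summable fun k => 2 * (P k ^ 2 + Q k ^ 2) := (h2.add h2').mul_left 2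
  have hs := hbig.of_nonneg_of_le (fun k => sq_nonneg _) hpt2
  refine ⟨hs, (hs.tsum_le_tsum hpt2 hbig).trans ?_⟩
  rw [tsum_mul_left, h2.tsum_add h2', mul_assoc]
  have hX := hfX.tsum_le_tsum hmono hf
  set S := ∑' j : ℤ, ((1 + |(j : ℝ)|) ^ 2 * ‖f j‖) ^ 2
  have h4 : ∑' k, Q k ^ 2 ≤ D * S * W := h3'.trans (by
    gcongr
    exact hl1b.trans (by gcongr))
  nlinarith

end Bounds

lemma memDX_single (k : ℤ) (z : ℂ) : memDX (Pi.single k z) := by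
  refine summable_of_hasFiniteSupport ((Set.finite_singleton k).subset fun j hj => ?_)
  by_contra hjk
  exact hj (by simp [Pi.single_eq_of_ne hjk])

lemma memDX.add {f h : ℤ → ℂ} (hf : memDX f) (hh : memDX h) : memDX (f + h) := by
  refine ((Summable.add hf hh).mul_left 2).of_nonneg_of_le (fun k => by positivity) fun k => ?_
  have h1 : ‖f k + h k‖ ^ 2 ≤ 2 * (‖f k‖ ^ 2 + ‖h k‖ ^ 2) := by
    have := norm_add_le (f k) (h k)
    nlinarith [norm_nonneg (f k + h k), sq_nonneg (‖f k‖ - ‖h k‖)]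
  calc (1 + (k : ℝ) ^ 2) * ‖(f + h) k‖ ^ 2
      ≤ (1 + (k : ℝ) ^ 2) * (2 * (‖f k‖ ^ 2 + ‖h k‖ ^ 2)) := by gcongr; exact h1
    _ = _ := by ring

lemma memDX.smul {f : ℤ → ℂ} (c : ℂ) (hf : memDX f) : memDX (c • f) := by
  refine (Summable.mul_left (‖c‖ ^ 2) hf).congr fun k => ?_
  rw [Pi.smul_apply, smul_eq_mul, norm_mul]
  ring

/-- Reparametrisation `(k, m) ↦ (k - m, -m)` of an absolutely convergent double series. -/
lemma tsum_tsum_reflect {H : ℤ × ℤ → ℂ} (hH : Summable H) :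
    ∑' k, ∑' m, H (k, m) = ∑' j, ∑' m, H (j - m, -m) := by
  let e : ℤ × ℤ ≃ ℤ × ℤ :=
    { toFun := fun p => (p.1 - p.2, -p.2)
      invFun := fun p => (p.1 - p.2, -p.2)
      left_inv := fun p => by simp
      right_inv := fun p => by simp }
  have hH' : Summable fun p : ℤ × ℤ => H (p.1 - p.2, -p.2) := (e.summable_iff (f := H)).2 hH
  have he : ∑' p : ℤ × ℤ, H (p.1 - p.2, -p.2) = ∑' p, H p := e.tsum_eq H
  rw [← hH.tsum_prod, ← hH'.tsum_prod, he]

lemma summable_prod_young {b f h : ℤ → ℝ} (hb : ∀ i, 0 ≤ b i) (hf : ∀ i, 0 ≤ f i)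
    (hh : ∀ i, 0 ≤ h i) (hbs : Summable b) (hfs : Summable fun i => f i ^ 2)
    (hhs : Summable fun i => h i ^ 2) :
    Summable fun p : ℤ × ℤ => b p.2 * f (p.1 - p.2) * h p.1 := by
  have h1 := (young_l1_l2 hb hf hbs hfs).1
  have h2 := (young_l1_l2 hb hf hbs hfs).2.1
  have h0 : (0 : ℤ × ℤ → ℝ) ≤ fun p => b p.2 * f (p.1 - p.2) * h p.1 :=
    fun p => mul_nonneg (mul_nonneg (hb _) (hf _)) (hh _)
  rw [summable_prod_of_nonneg h0]
  dsimp only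
  constructor
  · intro k
    exact (h1 k).mul_right (h k)
  have h3 := (summable_mul_and_sq_tsum_mul_le
    (fun k => tsum_nonneg fun m => mul_nonneg (hb m) (hf (k - m))) hh h2 hhs).1
  exact h3.congr fun k => tsum_mul_right.symm

section Operator

variable {g : ℝ → ℝ} (hF : Summable fun m : ℤ => ((1 + |(m : ℝ)|) ^ 2 * ‖fcoef g m‖) ^ 2)

/-- The operator `A_g` with domain `D_X`. -/
def agOp : l2Z →ₗ.[ℂ] l2Z where
  domain :=
    { carrier := {φ | memDX ⇑φ}
      zero_mem' := by simp [memDX]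
      add_mem' := fun hx hy => memDX.add hx hy
      smul_mem' := fun c _ hx => memDX.smul c hx }
  toFun :=
    { toFun := fun φ => ⟨agFun g ⇑(φ : l2Z), memℓp_agFun hF φ.2⟩
      map_add' := fun x y => by
        ext k
        change agFun g (⇑(x : l2Z) + ⇑(y : l2Z)) k = agFun g ⇑(x : l2Z) k + agFun g ⇑(y : l2Z) k
        rw [agFun, agFun, agFun, ← (summable_norm_agFun_term hF x.2 k).of_norm.tsum_add
          (summable_norm_agFun_term hF y.2 k).of_norm]
        exact tsum_congr fun m => by rw [Pi.add_apply, mul_add]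
      map_smul' := fun c x => by
        ext k
        change agFun g (c • ⇑(x : l2Z)) k = c * agFun g ⇑(x : l2Z) k
        rw [agFun, agFun, ← tsum_mul_left]
        exact tsum_congr fun m => by rw [Pi.smul_apply, smul_eq_mul]; ring }

lemma mem_agOp_domain (φ : l2Z) : φ ∈ (agOp hF).domain ↔ memDX ⇑φ := Iff.rfl

lemma agOp_apply (φ : (agOp hF).domain) (k : ℤ) :
    (agOp hF φ : l2Z) k = agFun g ⇑(φ : l2Z) k := rfl

include hF

/-- Formal symmetry of `A_g`, with one argument in `D_X` and the other one merely in `ℓ²`. -/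
lemma tsum_conj_agFun_mul {φ ψ : ℤ → ℂ} (hφ : memDX φ) (hψ : Summable fun k => ‖ψ k‖ ^ 2) :
    ∑' k, starRingEnd ℂ (agFun g φ k) * ψ k = ∑' j, starRingEnd ℂ (φ j) * agFun g ψ j := by
  have hH : Summable fun p : ℤ × ℤ =>
      starRingEnd ℂ (fcoef g p.2 * ((p.1 : ℂ) - (p.2 : ℂ) / 2) * φ (p.1 - p.2)) * ψ p.1 := by
    refine (summable_prod_young (b := fun m : ℤ => (1 + |(m : ℝ)|) * ‖fcoef g m‖)
      (f := fun j : ℤ => (1 + |(j : ℝ)|) * ‖φ j‖) (h := fun k => ‖ψ k‖)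
      (fun m => by positivity) (fun j => by positivity) (fun k => norm_nonneg _)
      (summable_one_add_abs_mul_fcoef hF) (memDX_iff.1 hφ) hψ).of_norm_bounded fun p => ?_
    rw [norm_mul, RCLike.norm_conj]
    exact mul_le_mul_of_nonneg_right (norm_agFun_term_le g φ p.1 p.2) (norm_nonneg _)
  have hL : ∀ k, starRingEnd ℂ (agFun g φ k) * ψ k = ∑' m : ℤ,
      starRingEnd ℂ (fcoef g m * ((k : ℂ) - (m : ℂ) / 2) * φ (k - m)) * ψ k := fun k => by
    rw [agFun, Complex.conj_tsum, ← tsum_mul_right]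
  simp only [hL]
  rw [tsum_tsum_reflect hH]
  refine tsum_congr fun j => ?_
  rw [agFun, ← tsum_mul_left]
  refine tsum_congr fun m => ?_
  simp only
  rw [fcoef_neg, sub_neg_eq_add, sub_add_cancel]
  simp only [map_mul, map_sub, map_div₀, Complex.conj_conj, map_intCast,
    map_ofNat (starRingEnd ℂ) 2]
  push_cast
  ring

end Operator

lemma l2Z_inner_eq_tsum (x y : l2Z) : ⟪x, y⟫ = ∑' k, starRingEnd ℂ (x k) * y k := by
  rw [lp.inner_eq_tsum]
  exact tsum_congr fun k => by rw [RCLike.inner_apply, mul_comm]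

/-- The smooth cutoff `n² / (n² + k²)` with `n = N + 1`. -/
def cutoff (N : ℕ) (k : ℤ) : ℝ := ((N : ℝ) + 1) ^ 2 / (((N : ℝ) + 1) ^ 2 + (k : ℝ) ^ 2)

lemma cutoff_nonneg (N : ℕ) (k : ℤ) : 0 ≤ cutoff N k := by unfold cutoff; positivity

lemma cutoff_le_one (N : ℕ) (k : ℤ) : cutoff N k ≤ 1 :=
  div_le_one_of_le₀ (by nlinarith [sq_nonneg (k : ℝ)]) (by positivity)

lemma tendsto_cutoff (k : ℤ) :
    Filter.Tendsto (fun N => cutoff N k) Filter.atTop (nhds 1) := by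
  have h1 : Filter.Tendsto (fun N : ℕ => ((N : ℝ) + 1) ^ 2) Filter.atTop Filter.atTop :=
    (Filter.tendsto_pow_atTop two_ne_zero).comp
      (Filter.tendsto_atTop_add_const_right _ _ tendsto_natCast_atTop_atTop)
  have h2 : Filter.Tendsto (fun N : ℕ => (k : ℝ) ^ 2 / (((N : ℝ) + 1) ^ 2 + (k : ℝ) ^ 2))
      Filter.atTop (nhds 0) :=
    (Filter.tendsto_atTop_add_const_right _ _ h1).const_div_atTop _
  have h3 := h2.const_sub 1
  rw [sub_zero] at h3
  refine h3.congr fun N => ?_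
  have : ((N : ℝ) + 1) ^ 2 + (k : ℝ) ^ 2 ≠ 0 := by positivity
  unfold cutoff
  field_simp
  ring

lemma one_add_sq_mul_cutoff_le (N : ℕ) (k : ℤ) :
    (1 + (k : ℝ) ^ 2) * cutoff N k ≤ ((N : ℝ) + 1) ^ 2 := by
  unfold cutoff
  rw [← mul_div_assoc, div_le_iff₀ (by positivity)]
  have : 1 ≤ ((N : ℝ) + 1) ^ 2 := by nlinarith [(Nat.cast_nonneg N : (0 : ℝ) ≤ N)]
  nlinarith [sq_nonneg (k : ℝ)]

/-- The commutator estimate for the cutoff. -/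
lemma abs_add_mul_cutoff_sub_le (N : ℕ) (j k : ℤ) :
    |((k : ℝ) + j) * (cutoff N j - cutoff N k)| ≤ 2 * |(k : ℝ) - j| := by
  unfold cutoff
  set n : ℝ := (N : ℝ) + 1 with hn
  have hnp : 0 < n := by positivity
  generalize (k : ℝ) = x
  generalize (j : ℝ) = y
  have h : (x + y) * (n ^ 2 / (n ^ 2 + y ^ 2) - n ^ 2 / (n ^ 2 + x ^ 2)) =
      (x - y) * (n ^ 2 * (x + y) ^ 2 / ((n ^ 2 + y ^ 2) * (n ^ 2 + x ^ 2))) := by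
    have h1 : n ^ 2 + y ^ 2 ≠ 0 := by positivity
    have h2 : n ^ 2 + x ^ 2 ≠ 0 := by positivity
    field_simp
    ring
  rw [h, abs_mul, mul_comm, abs_of_nonneg (by positivity : 0 ≤ n ^ 2 * (x + y) ^ 2 / _)]
  gcongr
  rw [div_le_iff₀ (by positivity)]
  nlinarith [mul_nonneg (sq_nonneg n) (sq_nonneg (x - y)), sq_nonneg (n ^ 2), sq_nonneg (x * y)]

lemma memDX_cutoff {f : ℤ → ℂ} (hf : Summable fun k => ‖f k‖ ^ 2) (N : ℕ) :
    memDX fun k => (cutoff N k : ℂ) * f k := by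
  refine (hf.mul_left (((N : ℝ) + 1) ^ 2)).of_nonneg_of_le (fun k => by positivity) fun k => ?_
  have h0 := cutoff_nonneg N k
  rw [norm_mul, Complex.norm_real, Real.norm_of_nonneg h0, mul_pow, ← mul_assoc]
  gcongr
  refine le_trans ?_ (one_add_sq_mul_cutoff_le N k)
  gcongr
  nlinarith [cutoff_le_one N k]

/-- Dominated convergence in `ℓ²(ℤ)`. -/
lemma l2Z_tendsto_of_dominated {u : ℕ → l2Z} {v : l2Z} {b : ℤ → ℝ}
    (hb : Summable fun k => b k ^ 2)
    (hlim : ∀ k, Filter.Tendsto (fun N => u N k) Filter.atTop (nhds (v k)))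
    (hle : ∀ N k, ‖u N k - v k‖ ≤ b k) :
    Filter.Tendsto u Filter.atTop (nhds v) := by
  have h : Filter.Tendsto (fun N => ∑' k, ‖u N k - v k‖ ^ 2) Filter.atTop
      (nhds (∑' _ : ℤ, (0 : ℝ))) := by
    refine tendsto_tsum_of_dominated_convergence hb (fun k => ?_) (Filter.Eventually.of_forall
      fun N k => ?_)
    · have := (((hlim k).sub_const (v k)).norm).pow 2
      simpa using this
    · rw [Real.norm_of_nonneg (by positivity)]
      gcongr
      exact hle N k
  rw [tsum_zero] at h
  have h2 : Filter.Tendsto (fun N => ‖u N - v‖ ^ 2) Filter.atTop (nhds 0) := by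
    refine h.congr fun N => ?_
    rw [l2Z_norm_sq]
    exact tsum_congr fun k => by rw [lp.coeFn_sub, Pi.sub_apply]
  rw [tendsto_iff_norm_sub_tendsto_zero]
  simpa [Real.sqrt_sq] using h2.sqrt

lemma norm_cutoff_mul_le (N : ℕ) (k : ℤ) (z : ℂ) : ‖(cutoff N k : ℂ) * z‖ ≤ ‖z‖ := by
  rw [norm_mul, Complex.norm_real, Real.norm_of_nonneg (cutoff_nonneg N k)]
  exact mul_le_of_le_one_left (norm_nonneg z) (cutoff_le_one N k)

/-- Truncation of an element of `ℓ²(ℤ)` by the cutoff. -/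
def truncate (N : ℕ) (ψ : l2Z) : l2Z :=
  ⟨fun k => (cutoff N k : ℂ) * ψ k, memℓp_two_of_summable_sq <|
    (l2Z_summable_sq ψ).of_nonneg_of_le (fun _ => sq_nonneg _) fun k =>
      pow_le_pow_left₀ (norm_nonneg _) (norm_cutoff_mul_le N k (ψ k)) 2⟩

lemma norm_cutoff_mul_sub_le (N : ℕ) (k : ℤ) (z : ℂ) : ‖(cutoff N k : ℂ) * z - z‖ ≤ ‖z‖ := by
  have h0 := cutoff_nonneg N k
  have h1 := cutoff_le_one N k
  have : (cutoff N k : ℂ) * z - z = ((cutoff N k - 1 : ℝ) : ℂ) * z := by push_cast; ring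
  rw [this, norm_mul, Complex.norm_real]
  refine mul_le_of_le_one_left (norm_nonneg _) ?_
  rw [Real.norm_eq_abs, abs_le]
  constructor <;> linarith

lemma tendsto_cutoff_mul (k : ℤ) (z : ℂ) :
    Filter.Tendsto (fun N => (cutoff N k : ℂ) * z) Filter.atTop (nhds z) := by
  have h := ((Complex.continuous_ofReal.tendsto 1).comp (tendsto_cutoff k)).mul_const z
  simpa using h

lemma tendsto_truncate (ψ : l2Z) :
    Filter.Tendsto (fun N => truncate N ψ) Filter.atTop (nhds ψ) :=
  l2Z_tendsto_of_dominated (l2Z_summable_sq ψ) (fun k => tendsto_cutoff_mul k (ψ k))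
    fun N k => norm_cutoff_mul_sub_le N k (ψ k)

section SelfAdjoint

variable {g : ℝ → ℝ} (hF : Summable fun m : ℤ => ((1 + |(m : ℝ)|) ^ 2 * ‖fcoef g m‖) ^ 2)

lemma truncate_mem_agOp_domain (N : ℕ) (ψ : l2Z) : truncate N ψ ∈ (agOp hF).domain :=
  memDX_cutoff (l2Z_summable_sq ψ) N

lemma agOp_dense : Dense ((agOp hF).domain : Set l2Z) := fun ψ =>
  mem_closure_of_tendsto (tendsto_truncate ψ)
    (Filter.Eventually.of_forall fun N => truncate_mem_agOp_domain hF N ψ)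

lemma agOp_symmetric : (agOp hF).IsFormalAdjoint (agOp hF) := fun x y => by
  rw [l2Z_inner_eq_tsum, l2Z_inner_eq_tsum]
  exact tsum_conj_agFun_mul hF x.2 (l2Z_summable_sq y)

/-- The adjoint of `A_g` acts by the same formal series. -/
lemma agOp_adjoint_apply (ψ : (agOp hF).adjoint.domain) (k : ℤ) :
    ((agOp hF).adjoint ψ : l2Z) k = agFun g ⇑(ψ : l2Z) k := by
  have hmem : (lp.single 2 k (1 : ℂ) : l2Z) ∈ (agOp hF).domain := memDX_single k 1
  have h := (LinearPMap.adjoint_isFormalAdjoint (agOp_dense hF)).symm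
    ⟨lp.single 2 k (1 : ℂ), hmem⟩ ψ
  rw [lp.inner_single_left, l2Z_inner_eq_tsum] at h
  have h2 := tsum_conj_agFun_mul hF (φ := Pi.single k 1) (memDX_single k 1)
    (l2Z_summable_sq (ψ : l2Z))
  rw [tsum_eq_single (L := .unconditional ℤ)
    (f := fun j => starRingEnd ℂ ((Pi.single k 1 : ℤ → ℂ) j) * agFun g (ψ : l2Z) j) k (fun j hj => by simp [Pi.single_eq_of_ne hj])] at h2
  have h3 := h.symm.trans h2
  simpa using h3

include hF in
/-- The defining series converges absolutely for every element of `ℓ²`. -/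
lemma summable_norm_agFun_term_l2 {f : ℤ → ℂ} (hf : Summable fun k => ‖f k‖ ^ 2) (k : ℤ) :
    Summable fun m : ℤ => ‖fcoef g m * ((k : ℂ) - (m : ℂ) / 2) * f (k - m)‖ := by
  have h := ((young_l1_l2 (fun m => by positivity) (fun j => norm_nonneg (f j))
    (summable_one_add_abs_mul_fcoef hF) hf).1 k).mul_left (1 + |(k : ℝ)|)
  refine h.of_nonneg_of_le (fun m => norm_nonneg _) fun m => ?_
  rw [norm_mul, norm_mul]
  have h1 : ‖(k : ℂ) - (m : ℂ) / 2‖ ≤ (1 + |(k : ℝ)|) * (1 + |(m : ℝ)|) := by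
    refine (norm_sub_le _ _).trans ?_
    rw [norm_div, Complex.norm_intCast, Complex.norm_intCast, Complex.norm_ofNat]
    nlinarith [abs_nonneg (k : ℝ), abs_nonneg (m : ℝ),
      mul_nonneg (abs_nonneg (k : ℝ)) (abs_nonneg (m : ℝ))]
  calc ‖fcoef g m‖ * ‖(k : ℂ) - (m : ℂ) / 2‖ * ‖f (k - m)‖
      ≤ ‖fcoef g m‖ * ((1 + |(k : ℝ)|) * (1 + |(m : ℝ)|)) * ‖f (k - m)‖ := by gcongr
    _ = _ := by ring

include hF in
/-- The commutator of `A_g` with the cutoff is bounded on `ℓ²`, uniformly in the cutoff. -/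
lemma norm_agFun_cutoff_sub_le {f : ℤ → ℂ} (hf : Summable fun k => ‖f k‖ ^ 2) (N : ℕ) (k : ℤ) :
    ‖agFun g (fun j => (cutoff N j : ℂ) * f j) k - (cutoff N k : ℂ) * agFun g f k‖ ≤
      ∑' m : ℤ, (1 + |(m : ℝ)|) * ‖fcoef g m‖ * ‖f (k - m)‖ := by
  have hc := (summable_norm_agFun_term hF (memDX_cutoff hf N) k).of_norm
  have hs := (summable_norm_agFun_term_l2 hF hf k).of_norm.mul_left (cutoff N k : ℂ)
  rw [agFun, agFun, ← tsum_mul_left, ← hc.tsum_sub hs]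
  refine tsum_of_norm_bounded ((young_l1_l2 (fun m => by positivity) (fun j => norm_nonneg (f j))
    (summable_one_add_abs_mul_fcoef hF) hf).1 k).hasSum fun m => ?_
  have heq : fcoef g m * ((k : ℂ) - (m : ℂ) / 2) * ((cutoff N (k - m) : ℂ) * f (k - m)) -
      (cutoff N k : ℂ) * (fcoef g m * ((k : ℂ) - (m : ℂ) / 2) * f (k - m)) =
      fcoef g m * f (k - m) * ((((k : ℝ) + ((k - m : ℤ) : ℝ)) *
        (cutoff N (k - m) - cutoff N k) / 2 : ℝ) : ℂ) := by
    push_cast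
    ring
  rw [heq, norm_mul, norm_mul, Complex.norm_real, Real.norm_eq_abs, abs_div, abs_two]
  have h1 := abs_add_mul_cutoff_sub_le N (k - m) k
  have h2 : (k : ℝ) - ((k - m : ℤ) : ℝ) = m := by push_cast; ring
  rw [h2] at h1
  calc ‖fcoef g m‖ * ‖f (k - m)‖ *
        (|((k : ℝ) + ((k - m : ℤ) : ℝ)) * (cutoff N (k - m) - cutoff N k)| / 2)
      ≤ ‖fcoef g m‖ * ‖f (k - m)‖ * (1 + |(m : ℝ)|) := by
        gcongr
        linarith
    _ = _ := by ring

include hF in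
lemma tendsto_agFun_cutoff {f : ℤ → ℂ} (hf : Summable fun k => ‖f k‖ ^ 2) (k : ℤ) :
    Filter.Tendsto (fun N => agFun g (fun j => (cutoff N j : ℂ) * f j) k) Filter.atTop
      (nhds (agFun g f k)) := by
  refine tendsto_tsum_of_dominated_convergence (summable_norm_agFun_term_l2 hF hf k)
    (fun m => (tendsto_cutoff_mul (k - m) (f (k - m))).const_mul _)
    (Filter.Eventually.of_forall fun N m => ?_)
  rw [norm_mul, norm_mul (_ * _)]
  gcongr
  exact norm_cutoff_mul_le N (k - m) (f (k - m))

lemma agOp_adjoint_graph_le :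
    (agOp hF).adjoint.graph ≤ (agOp hF).graph.topologicalClosure := by
  rintro ⟨ψ, η⟩ h
  obtain ⟨ψ', rfl, hη⟩ := (LinearPMap.mem_graph_iff _).1 h
  obtain ⟨-, hS, -⟩ := young_l1_l2 (fun m => by positivity) (fun j => norm_nonneg ((ψ' : l2Z) j))
    (summable_one_add_abs_mul_fcoef hF) (l2Z_summable_sq (ψ' : l2Z))
  dsimp only at hη ⊢
  have hηk : ∀ k, η k = agFun g (ψ' : l2Z) k := fun k => by
    rw [← hη]; exact agOp_adjoint_apply hF ψ' k
  have hA : Filter.Tendsto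
      (fun N => agOp hF ⟨truncate N ψ', truncate_mem_agOp_domain hF N ψ'⟩) Filter.atTop
      (nhds η) := by
    refine l2Z_tendsto_of_dominated (b := fun k => (∑' m : ℤ, (1 + |(m : ℝ)|) * ‖fcoef g m‖ *
      ‖(ψ' : l2Z) (k - m)‖) + ‖η k‖) ?_ (fun k => ?_) fun N k => ?_
    · refine ((hS.add (l2Z_summable_sq η)).mul_left 2).of_nonneg_of_le (fun _ => sq_nonneg _)
        fun k => ?_
      exact add_sq_le
    · rw [hηk k]
      exact tendsto_agFun_cutoff hF (l2Z_summable_sq (ψ' : l2Z)) k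
    · have h1 := norm_agFun_cutoff_sub_le hF (l2Z_summable_sq (ψ' : l2Z)) N k
      rw [← hηk k] at h1
      have h2 := norm_cutoff_mul_sub_le N k (η k)
      exact (norm_sub_le_norm_sub_add_norm_sub _ _ _).trans (add_le_add h1 h2)
  exact mem_closure_of_tendsto ((tendsto_truncate (ψ' : l2Z)).prodMk_nhds hA)
    (Filter.Eventually.of_forall fun N =>
      (agOp hF).mem_graph ⟨truncate N ψ', truncate_mem_agOp_domain hF N ψ'⟩)

end SelfAdjoint

/-- Lemma 2.5 ("sa"), one-dimensional case: for a `2π`-periodic `C²` real function `g`,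
the series defining `A_g φ` converges absolutely for `φ ∈ D_X` and defines an element of
`ℓ²(ℤ)`; the operator `A_g` with domain `D_X` is symmetric and essentially self-adjoint;
moreover `‖A_g φ‖² ≤ c(‖φ‖² + ‖Xφ‖²)` on `D_X` and
`‖A_g²φ‖² ≤ c(‖φ‖² + ‖X²φ‖²)` on `D(X²)` (in particular `A_g φ ∈ D_X` there). -/
theorem stmt2 (g : ℝ → ℝ) (hper : ∀ θ : ℝ, g (θ + 2 * Real.pi) = g θ)
    (hreg : ContDiff ℝ 2 g) :
    -- (a) absolute convergence of the defining series, for φ ∈ D_X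
    (∀ φ : l2Z, memDX ⇑φ → ∀ k : ℤ,
      Summable fun m : ℤ => ‖fcoef g m * ((k : ℂ) - (m : ℂ) / 2) * φ (k - m)‖) ∧
    -- (b) A_g φ ∈ ℓ²(ℤ) for φ ∈ D_X
    (∀ φ : l2Z, memDX ⇑φ → Memℓp (agFun g ⇑φ) 2) ∧
    -- (c) the operator A_g with domain D_X is densely defined, symmetric and
    -- essentially self-adjoint (its closure is self-adjoint)
    (∃ A : l2Z →ₗ.[ℂ] l2Z,
      (∀ φ : l2Z, φ ∈ A.domain ↔ memDX ⇑φ) ∧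
      (∀ (φ : l2Z) (hφ : φ ∈ A.domain) (k : ℤ), (A ⟨φ, hφ⟩ : l2Z) k = agFun g ⇑φ k) ∧
      Dense (A.domain : Set l2Z) ∧
      (∀ x y : A.domain, ⟪A x, (y : l2Z)⟫ = ⟪(x : l2Z), A y⟫) ∧
      A.IsClosable ∧ A.closure.adjoint = A.closure) ∧
    -- (d) the quantitative bounds
    (∃ c > (0 : ℝ),
      (∀ φ : l2Z, memDX ⇑φ →
        ∑' k : ℤ, ‖agFun g ⇑φ k‖ ^ 2 ≤
          c * (‖φ‖ ^ 2 + ∑' k : ℤ, (k : ℝ) ^ 2 * ‖φ k‖ ^ 2)) ∧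
      (∀ φ : l2Z, (Summable fun k : ℤ => (1 + (k : ℝ) ^ 2) ^ 2 * ‖φ k‖ ^ 2) →
        memDX (agFun g ⇑φ) ∧
        ∑' k : ℤ, ‖agFun g (agFun g ⇑φ) k‖ ^ 2 ≤
          c * (‖φ‖ ^ 2 + ∑' k : ℤ, (k : ℝ) ^ 4 * ‖φ k‖ ^ 2))) := by
  have hF := summable_weighted_fcoef hper hreg
  refine ⟨fun φ hφ k => summable_norm_agFun_term hF hφ k, fun φ hφ => memℓp_agFun hF hφ,
    ⟨agOp hF, mem_agOp_domain hF, fun φ hφ k => agOp_apply hF ⟨φ, hφ⟩ k, agOp_dense hF,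
      agOp_symmetric hF, essentiallySelfAdjoint_of_adjoint_graph_le (agOp_dense hF)
        (agOp_symmetric hF) (agOp_adjoint_graph_le hF)⟩, ?_⟩
  obtain ⟨C, hC, hX⟩ := exists_weighted_agFun_sq_bound hF
  set B := ∑' m : ℤ, (1 + |(m : ℝ)|) * ‖fcoef g m‖
  have hpos : 0 < 2 * B ^ 2 + B ^ 2 * (8 * C) + 1 := by positivity
  refine ⟨2 * B ^ 2 + B ^ 2 * (8 * C) + 1, hpos, fun φ hφ => ?_, fun φ hφ => ?_⟩
  · have hφX : Summable fun k : ℤ => (k : ℝ) ^ 2 * ‖φ k‖ ^ 2 :=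
      Summable.of_nonneg_of_le (fun k => by positivity) (fun k => by gcongr; linarith) hφ
    have hN := l2Z_norm_sq φ
    have hle := (memDX_iff.1 hφ).tsum_le_tsum (g := fun k : ℤ =>
        2 * (‖φ k‖ ^ 2 + (k : ℝ) ^ 2 * ‖φ k‖ ^ 2)) (fun k => by
      rw [mul_pow]
      nlinarith [mul_le_mul_of_nonneg_right (one_add_abs_sq_le (k : ℝ)) (sq_nonneg ‖φ k‖)])
      (((l2Z_summable_sq φ).add hφX).mul_left 2)
    rw [tsum_mul_left, (l2Z_summable_sq φ).tsum_add hφX, ← hN] at hle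
    have hS : 0 ≤ ‖φ‖ ^ 2 + ∑' k : ℤ, (k : ℝ) ^ 2 * ‖φ k‖ ^ 2 :=
      add_nonneg (sq_nonneg _) (tsum_nonneg fun k => by positivity)
    refine (agFun_sq_bound hF hφ).2.trans ?_
    refine (mul_le_mul_of_nonneg_left hle (sq_nonneg B)).trans ?_
    have : 0 ≤ B ^ 2 * (8 * C) + 1 := by positivity
    nlinarith [mul_nonneg this hS]
  · have hφX : Summable fun k : ℤ => (k : ℝ) ^ 4 * ‖φ k‖ ^ 2 :=
      hφ.of_nonneg_of_le (fun k => by positivity) fun k => by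
        gcongr
        nlinarith [sq_nonneg (k : ℝ)]
    have hpt : ∀ k : ℤ, ((1 + |(k : ℝ)|) ^ 2 * ‖φ k‖) ^ 2 ≤
        8 * (‖φ k‖ ^ 2 + (k : ℝ) ^ 4 * ‖φ k‖ ^ 2) := fun k => by
      have h1 : ((1 + |(k : ℝ)|) ^ 2) ^ 2 ≤ 8 * (1 + (k : ℝ) ^ 4) := by
        have h2 := one_add_abs_sq_le (k : ℝ)
        nlinarith [sq_nonneg (1 + |(k : ℝ)|), sq_nonneg (1 - (k : ℝ) ^ 2)]
      rw [mul_pow]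
      nlinarith [mul_le_mul_of_nonneg_right h1 (sq_nonneg ‖φ k‖)]
    have hbig := ((l2Z_summable_sq φ).add hφX).mul_left 8
    have hsum := hbig.of_nonneg_of_le (fun k => sq_nonneg _) hpt
    have hle := hsum.tsum_le_tsum hpt hbig
    rw [tsum_mul_left, (l2Z_summable_sq φ).tsum_add hφX, ← l2Z_norm_sq φ] at hle
    have hS : 0 ≤ ‖φ‖ ^ 2 + ∑' k : ℤ, (k : ℝ) ^ 4 * ‖φ k‖ ^ 2 :=
      add_nonneg (sq_nonneg _) (tsum_nonneg fun k => by positivity)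
    obtain ⟨hA, hAb⟩ := hX φ hsum
    have hAX : memDX (agFun g φ) := memDX_iff.2 hA
    refine ⟨hAX, (agFun_sq_bound hF hAX).2.trans ?_⟩
    calc B ^ 2 * ∑' k : ℤ, ((1 + |(k : ℝ)|) * ‖agFun g φ k‖) ^ 2
        ≤ B ^ 2 * (C * (8 * (‖φ‖ ^ 2 + ∑' k : ℤ, (k : ℝ) ^ 4 * ‖φ k‖ ^ 2))) := by
          gcongr
          exact hAb.trans (by gcongr)
      _ = B ^ 2 * (8 * C) * (‖φ‖ ^ 2 + ∑' k : ℤ, (k : ℝ) ^ 4 * ‖φ k‖ ^ 2) := by ring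
      _ ≤ _ := by
          gcongr
          nlinarith [sq_nonneg B]
end
end

section
/- Let a > 1 and let γ = (γ_k)_{k∈ℤ} be a bounded complex sequence with q₂(γ) < ∞. Then D_γ is of class C²(A_a): there exist bounded operators B₁ and B₂ on ℓ²(ℤ) such that ⟨A_a φ, D_γ ψ⟩ − ⟨φ, D_γ(A_a ψ)⟩ = ⟨φ, B₁ψ⟩ and ⟨A_a φ, B₁ψ⟩ − ⟨φ, B₁(A_a ψ)⟩ = ⟨φ, B₂ψ⟩ for all φ, ψ ∈ D_X. -/
open scoped ComplexInnerProductSpace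

noncomputable section

/-- The basis vector `e_k` of `ℓ²(ℤ)`. -/
abbrev l2Z.basisVec (k : ℤ) : l2Z := lp.single 2 k (1 : ℂ)

namespace l2Z

lemma basisVec_apply (k j : ℤ) : basisVec k j = if j = k then 1 else 0 := by
  rw [basisVec, lp.single_apply, Pi.single_apply]

lemma sum_sq_weightedShift_le {c : ℤ → ℂ} {M : ℝ} (hc : ∀ k, ‖c k‖ ≤ M) (m : ℤ) (φ : l2Z)
    (s : Finset ℤ) :
    ∑ k ∈ s, ‖c k * φ (k - m)‖ ^ (2 : ENNReal).toReal ≤ (M * ‖φ‖) ^ (2 : ENNReal).toReal := by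
  have h := lp.sum_rpow_le_norm_rpow (p := 2) (by norm_num) φ (s.image fun k => k - m)
  rw [Finset.sum_image fun x _ y _ hxy => by simpa using hxy] at h
  simp only [ENNReal.toReal_ofNat, Real.rpow_ofNat, norm_mul, mul_pow] at h ⊢
  refine le_trans ?_ (mul_le_mul_of_nonneg_left h (sq_nonneg M))
  rw [Finset.mul_sum]
  gcongr with k _
  exact hc k

/-- The weighted shift `φ ↦ (c_k φ_{k-m})_k` for a bounded weight `c`. -/
lemma exists_weightedShift {c : ℤ → ℂ} {M : ℝ} (hc : ∀ k, ‖c k‖ ≤ M) (m : ℤ) :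
    ∃ T : l2Z →L[ℂ] l2Z, ‖T‖ ≤ M ∧ ∀ (φ : l2Z) (k : ℤ), T φ k = c k * φ (k - m) := by
  have hM : 0 ≤ M := (norm_nonneg _).trans (hc 0)
  let L : l2Z →ₗ[ℂ] l2Z :=
    { toFun := fun φ =>
        ⟨fun k => c k * φ (k - m), memℓp_gen' (sum_sq_weightedShift_le hc m φ)⟩
      map_add' := fun φ ψ => by
        ext k
        exact mul_add (c k) (φ (k - m)) (ψ (k - m))
      map_smul' := fun z φ => by
        ext k
        exact mul_left_comm (c k) z (φ (k - m)) }
  have hL : ∀ φ, ‖L φ‖ ≤ M * ‖φ‖ := fun φ =>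
    lp.norm_le_of_forall_sum_le (by norm_num) (by positivity) (sum_sq_weightedShift_le hc m φ)
  exact ⟨L.mkContinuous M hL, L.mkContinuous_norm_le hM hL, fun φ k => rfl⟩

/-- A matrix dominated by a summable function of the distance to the diagonal is the matrix of a
bounded operator. -/
lemma exists_clm_of_matrix {K : ℤ → ℤ → ℂ} {w : ℤ → ℝ} (hw : Summable w)
    (hK : ∀ k l, ‖K k l‖ ≤ w (k - l)) :
    ∃ T : l2Z →L[ℂ] l2Z, ∀ k l, T (basisVec l) k = K k l := by
  have hdiag : ∀ m k, ‖K k (k - m)‖ ≤ w m := fun m k => by simpa using hK k (k - m)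
  choose S hS hS' using fun m => exists_weightedShift (hdiag m) m
  have hsum : Summable S := Summable.of_norm_bounded hw hS
  refine ⟨∑' m, S m, fun k l => ?_⟩
  have hcoord : HasSum (fun m => S m (basisVec l) k) ((∑' m, S m) (basisVec l) k) :=
    (hsum.hasSum.mapL (ContinuousLinearMap.apply ℂ l2Z (basisVec l))).mapL
      (lp.evalCLM ℂ (fun _ : ℤ => ℂ) 2 k)
  have hterm : ∀ m, S m (basisVec l) k = if m = k - l then K k l else 0 := fun m => by
    rw [hS', basisVec_apply]
    by_cases hm : m = k - l
    · subst hm; simp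
    · rw [if_neg (by omega), if_neg hm, mul_zero]
  simp only [hterm] at hcoord
  exact hcoord.unique (hasSum_ite_eq (k - l) (K k l))

/-- A bounded operator acts through its matrix. -/
lemma hasSum_matrix (T : l2Z →L[ℂ] l2Z) (φ : l2Z) (k : ℤ) :
    HasSum (fun j => T (basisVec j) k * φ j) (T φ k) := by
  have hcoord : HasSum (fun j => T (lp.single 2 j (φ j)) k) (T φ k) :=
    ((lp.hasSum_single (p := 2) (by norm_num) φ).mapL T).mapL
      (lp.evalCLM ℂ (fun _ : ℤ => ℂ) 2 k)
  have hterm : ∀ j, T (lp.single 2 j (φ j)) k = T (basisVec j) k * φ j := fun j => by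
    have : (lp.single 2 j (φ j) : l2Z) = φ j • basisVec j := by
      rw [basisVec, ← lp.single_smul, smul_eq_mul, mul_one]
    rw [this, map_smul, lp.coeFn_smul, Pi.smul_apply, smul_eq_mul, mul_comm]
  simpa only [hterm] using hcoord

lemma clm_ext {S T : l2Z →L[ℂ] l2Z} (h : ∀ k l, S (basisVec l) k = T (basisVec l) k) : S = T := by
  ext φ k
  refine (hasSum_matrix S φ k).unique ?_
  simpa only [h] using hasSum_matrix T φ k

/-- If `T` has the matrix `(A_{kl} r_l)` with `A` symmetric and `r`, `A` real, and `C` has the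
formal matrix of the commutator `[A, B]`, then `C` is the commutator in the weak sense on the range
of the diagonal operator `R` of `r`. -/
lemma inner_commutator {A : ℤ → ℤ → ℝ} (hA : ∀ k l, A k l = A l k) {r : ℤ → ℝ}
    {R T B C : l2Z →L[ℂ] l2Z} (hR : ∀ φ k, R φ k = r k * φ k)
    (hT : ∀ k l, T (basisVec l) k = A k l * r l)
    (hC : ∀ k l, C (basisVec l) k =
      ∑' j, ((A k j : ℂ) * B (basisVec l) j - B (basisVec j) k * A j l)) (u v : l2Z) :
    ⟪T u, B (R v)⟫ - ⟪R u, B (T v)⟫ = ⟪R u, C (R v)⟫ := by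
  have hRe : ∀ k, R (basisVec k) = (r k : ℂ) • basisVec k := fun k => by
    ext j
    rw [hR, lp.coeFn_smul, Pi.smul_apply, smul_eq_mul, basisVec_apply]
    split_ifs with h
    · rw [h]
    · simp
  have key : (ContinuousLinearMap.adjoint T ∘L B ∘L R - ContinuousLinearMap.adjoint R ∘L B ∘L T) =
      ContinuousLinearMap.adjoint R ∘L C ∘L R := by
    refine clm_ext fun k l => ?_
    have hcoord : ∀ f : l2Z, f k = ⟪basisVec k, f⟫ := fun f => by
      rw [lp.inner_single_left]; simp
    rw [hcoord, hcoord]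
    simp only [sub_apply, ContinuousLinearMap.comp_apply, inner_sub_right,
      ContinuousLinearMap.adjoint_inner_right]
    rw [hRe, hRe]
    simp only [map_smul, inner_smul_left, inner_smul_right, ← hcoord, Complex.conj_ofReal]
    have h1 := lp.hasSum_inner (𝕜 := ℂ) (T (basisVec k)) (B (basisVec l))
    have h2 := hasSum_matrix B (T (basisVec l)) k
    have h3 := ((h1.mul_left (r l : ℂ)).sub (h2.mul_left (r k : ℂ))).tsum_eq
    rw [← h3, hC, ← tsum_mul_left, ← tsum_mul_left]
    refine tsum_congr fun j => ?_
    rw [hT, hT, RCLike.inner_apply, hA j k]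
    simp only [map_mul, Complex.conj_ofReal]
    ring
  have := congrArg (fun M : l2Z →L[ℂ] l2Z => ⟪u, M v⟫) key
  simpa only [sub_apply, ContinuousLinearMap.comp_apply, inner_sub_right,
    ContinuousLinearMap.adjoint_inner_right] using this

end l2Z

/-- The weight `1 + |k|` on the integers. -/
def intWeight (k : ℤ) : ℝ := 1 + |(k : ℝ)|

lemma one_le_intWeight (k : ℤ) : 1 ≤ intWeight k := by simp [intWeight]

lemma intWeight_pos (k : ℤ) : 0 < intWeight k := one_pos.trans_le (one_le_intWeight k)

lemma abs_le_intWeight (k : ℤ) : |(k : ℝ)| ≤ intWeight k := by simp [intWeight]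

lemma intWeight_neg (k : ℤ) : intWeight (-k) = intWeight k := by simp [intWeight]

lemma intWeight_sub_comm (k l : ℤ) : intWeight (k - l) = intWeight (l - k) := by
  rw [← intWeight_neg, neg_sub]

lemma intWeight_add_le (k l : ℤ) : intWeight (k + l) ≤ intWeight k * intWeight l := by
  have h := abs_add_le (k : ℝ) l
  have := mul_nonneg (abs_nonneg (k : ℝ)) (abs_nonneg (l : ℝ))
  simp only [intWeight, Int.cast_add]
  nlinarith

lemma intWeight_le_mul_sub (k l : ℤ) : intWeight k ≤ intWeight l * intWeight (k - l) := by
  simpa using intWeight_add_le l (k - l)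

lemma abs_add_le_intWeight (k l : ℤ) :
    |(k : ℝ) + l| ≤ 2 * (intWeight k * intWeight (k - l)) := by
  have h1 := abs_add_le (k : ℝ) l
  have h2 := abs_le_intWeight k
  have h3 := abs_le_intWeight l
  have h4 := intWeight_le_mul_sub l k
  rw [intWeight_sub_comm] at h4
  have h5 := le_mul_of_one_le_right (intWeight_pos k).le (one_le_intWeight (k - l))
  linarith

/-- If the increments of `u` decay like `|k|^{-p}`, then so do the differences `u_k - u_l`, up to a
factor polynomial in `k - l`. -/
lemma weighted_sub_le {u : ℤ → ℂ} {p : ℕ} {C : ℝ}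
    (hu : ∀ k, intWeight k ^ p * ‖u k - u (k + 1)‖ ≤ C) (k l : ℤ) :
    intWeight k ^ p * ‖u k - u l‖ ≤ C * intWeight (k - l) ^ (2 * p + 1) := by
  have hC : 0 ≤ C := le_trans (by have := intWeight_pos 0; positivity) (hu 0)
  have aux : ∀ (n : ℕ) (i c : ℤ), |c - i| ≤ n → |c - (i + n)| ≤ n →
      intWeight c ^ p * ‖u i - u (i + n)‖ ≤ n * (C * (1 + n : ℝ) ^ p) := by
    intro n i c hi hn
    have step : ∀ t : ℕ, t < n → intWeight c ^ p * ‖u (i + t) - u (i + t + 1)‖ ≤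
        C * (1 + n : ℝ) ^ p := by
      intro t ht
      have h1 := intWeight_le_mul_sub c (i + t)
      have h2 : intWeight (c - (i + t)) ≤ 1 + n := by
        have : |c - (i + t)| ≤ n := by rw [abs_le] at *; omega
        have : ((|c - (i + t)| : ℤ) : ℝ) ≤ ((n : ℤ) : ℝ) := by exact_mod_cast this
        simpa [intWeight] using this
      have hpos := intWeight_pos (i + t)
      have h3 : intWeight c ≤ intWeight (i + t) * (1 + n) :=
        h1.trans (mul_le_mul_of_nonneg_left h2 hpos.le)
      calc intWeight c ^ p * ‖u (i + t) - u (i + t + 1)‖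
          ≤ (intWeight (i + t) * (1 + n)) ^ p * ‖u (i + t) - u (i + t + 1)‖ := by
            have := (intWeight_pos c).le
            gcongr
        _ = (intWeight (i + t) ^ p * ‖u (i + t) - u (i + t + 1)‖) * (1 + n : ℝ) ^ p := by
            rw [mul_pow]; ring
        _ ≤ C * (1 + n : ℝ) ^ p := by gcongr; exact hu _
    have tele : ∀ t : ℕ, t ≤ n → intWeight c ^ p * ‖u i - u (i + t)‖ ≤
        t * (C * (1 + n : ℝ) ^ p) := by
      intro t
      induction t with
      | zero => intro _; simp
      | succ t ih =>
        intro ht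
        have h1 := ih (by omega)
        have h2 := step t (by omega)
        have h3 := norm_sub_le_norm_sub_add_norm_sub (u i) (u (i + t)) (u (i + t + 1))
        have h4 := mul_le_mul_of_nonneg_left h3 (pow_nonneg (intWeight_pos c).le p)
        push_cast
        rw [← add_assoc]
        linarith
    exact tele n le_rfl
  have fin : ∀ n : ℕ, intWeight (k - l) = 1 + n →
      (n : ℝ) * (C * (1 + n : ℝ) ^ p) ≤ C * intWeight (k - l) ^ (2 * p + 1) := by
    intro n hn
    rw [hn]
    have h1 : (1 : ℝ) ≤ (1 + n : ℝ) ^ p := one_le_pow₀ (by simp)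
    have h2 : (n : ℝ) ≤ (1 + n) * (1 + n : ℝ) ^ p := by nlinarith [(n.cast_nonneg : (0 : ℝ) ≤ n)]
    calc (n : ℝ) * (C * (1 + n : ℝ) ^ p) ≤
        ((1 + n) * (1 + n : ℝ) ^ p) * (C * (1 + n : ℝ) ^ p) := by gcongr
      _ = C * (1 + n : ℝ) ^ (2 * p + 1) := by ring
  rcases le_total k l with h | h
  · obtain ⟨n, rfl⟩ := Int.le.dest h
    refine (aux n k k (by simp) (by simp)).trans (fin n ?_)
    simp [intWeight]
  · obtain ⟨n, rfl⟩ := Int.le.dest h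
    rw [norm_sub_rev]
    refine (aux n l (l + n) (by simp) (by simp)).trans (fin n ?_)
    simp [intWeight]

/-- Mixed second differences of a sequence whose second differences decay like `k^{-2}`. -/
lemma weighted_mixed_sub_le {γ : ℤ → ℂ} {C : ℝ}
    (hγ : ∀ k, intWeight k ^ 2 * ‖γ k - 2 * γ (k + 1) + γ (k + 2)‖ ≤ C) (k j l : ℤ) :
    intWeight k ^ 2 * ‖γ k + γ l - γ j - γ (k + l - j)‖ ≤
      C * intWeight (k - j) ^ 5 * intWeight (j - l) ^ 5 := by
  have h1 : ∀ i m : ℤ, intWeight i ^ 2 * ‖(γ i - γ (i + 1)) - (γ m - γ (m + 1))‖ ≤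
      C * intWeight (i - m) ^ 5 := fun i m =>
    weighted_sub_le (u := fun i => γ i - γ (i + 1)) (p := 2) (fun i => by
      convert hγ i using 3
      rw [add_assoc, one_add_one_eq_two]
      ring) i m
  have h2 := weighted_sub_le (u := fun i => γ i - γ (i + (j - k))) (p := 2)
    (C := C * intWeight (k - j) ^ 5) (fun i => by
      convert h1 i (i + (j - k)) using 3
      · rw [add_right_comm i 1]
        ring
      · ring_nf) k (k + l - j)
  convert h2 using 3
  · rw [show k + (j - k) = j by ring, show k + l - j + (j - k) = l by ring]
    ring
  · ring_nf

/-- A sequence is `O(|k|^{-p})` if it is bounded and `k^p` times it is bounded. -/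
lemma exists_weighted_bound {u : ℤ → ℂ} {p : ℕ} {M N : ℝ} (h0 : ∀ k, ‖u k‖ ≤ M)
    (hp : ∀ k : ℤ, ‖(k : ℂ) ^ p * u k‖ ≤ N) (k : ℤ) :
    intWeight k ^ p * ‖u k‖ ≤ 2 ^ p * (M + N) := by
  have h1 := h0 k
  have h2 := hp k
  rw [norm_mul, norm_pow, Complex.norm_intCast] at h2
  have h3 : intWeight k ^ p ≤ 2 ^ p * (1 + |(k : ℝ)| ^ p) := by
    have : intWeight k ≤ 2 * max 1 |(k : ℝ)| := by
      have := le_max_left 1 |(k : ℝ)|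
      have := le_max_right 1 |(k : ℝ)|
      rw [intWeight]; linarith
    refine (pow_le_pow_left₀ (intWeight_pos k).le this p).trans ?_
    rw [mul_pow]
    gcongr
    rcases max_choice 1 |(k : ℝ)| with h | h <;> rw [h] <;> simp
  calc intWeight k ^ p * ‖u k‖ ≤ 2 ^ p * (1 + |(k : ℝ)| ^ p) * ‖u k‖ := by gcongr
    _ = 2 ^ p * (‖u k‖ + |(k : ℝ)| ^ p * ‖u k‖) := by ring
    _ ≤ _ := by gcongr

lemma summable_intWeight_pow_mul_geometric {θ : ℝ} (h0 : 0 ≤ θ) (h1 : θ < 1) (p : ℕ) :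
    Summable fun m : ℤ => intWeight m ^ p * θ ^ m.natAbs := by
  have key : Summable fun n : ℕ => (1 + n : ℝ) ^ p * θ ^ n := by
    rcases h0.eq_or_lt with rfl | hpos
    · exact summable_of_ne_finset_zero (s := {0}) fun n hn => by
        rw [zero_pow (by simpa using hn), mul_zero]
    have h := (summable_nat_add_iff 1).2
      (summable_pow_mul_geometric_of_norm_lt_one (R := ℝ) p (r := θ)
        (by rwa [Real.norm_of_nonneg h0]))
    refine (summable_congr fun n => ?_).1 (h.mul_left θ⁻¹)
    push_cast
    field_simp
    ring
  refine Summable.of_nat_of_neg ?_ ?_ <;> simpa [intWeight] using key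

/-- The matrix of the conjugate operator `A_a`, where `θ = a^{-1/2}`. -/
def conjMatrix (θ : ℝ) (k l : ℤ) : ℝ :=
  if k = l then 0 else 1 / 2 * θ ^ (2 * (k - l).natAbs) * (k + l)

lemma conjMatrix_symm (θ : ℝ) (k l : ℤ) : conjMatrix θ k l = conjMatrix θ l k := by
  simp only [conjMatrix, eq_comm (a := k), show (k - l).natAbs = (l - k).natAbs by omega,
    add_comm (k : ℝ)]

lemma abs_conjMatrix_le {θ : ℝ} (h0 : 0 ≤ θ) (k l : ℤ) :
    |conjMatrix θ k l| ≤ θ ^ (2 * (k - l).natAbs) * (intWeight k * intWeight (k - l)) := by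
  have hk := intWeight_pos k
  have hkl := intWeight_pos (k - l)
  rw [conjMatrix]
  split_ifs with h
  · rw [abs_zero]; positivity
  · have hθ : 0 ≤ θ ^ (2 * (k - l).natAbs) := by positivity
    rw [abs_mul, abs_mul, abs_of_nonneg hθ, abs_of_pos one_half_pos]
    have := mul_le_mul_of_nonneg_left (abs_add_le_intWeight k l) hθ
    linarith

lemma pow_two_mul_natAbs_le {θ : ℝ} (h0 : 0 ≤ θ) (h1 : θ ≤ 1) (m : ℤ) :
    θ ^ (2 * m.natAbs) ≤ θ ^ m.natAbs :=
  pow_le_pow_of_le_one h0 h1 (by omega)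

/-- The matrix of the first commutator of `A_a` with `D_γ`. -/
def commMatrix (θ : ℝ) (γ : ℤ → ℂ) (k l : ℤ) : ℂ := conjMatrix θ k l * (γ l - γ k)

lemma norm_commMatrix_le {θ : ℝ} (h0 : 0 ≤ θ) (h1 : θ ≤ 1) {γ : ℤ → ℂ} {C : ℝ}
    (hγ : ∀ k, intWeight k ^ 1 * ‖γ k - γ (k + 1)‖ ≤ C) (k l : ℤ) :
    ‖commMatrix θ γ k l‖ ≤ C * (intWeight (k - l) ^ 4 * θ ^ (k - l).natAbs) := by
  have h := weighted_sub_le hγ k l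
  have hkl := intWeight_pos (k - l)
  have hk := intWeight_pos k
  have hC : 0 ≤ C := le_trans (by positivity) (hγ k)
  rw [commMatrix, norm_mul, Complex.norm_real, Real.norm_eq_abs, norm_sub_rev]
  calc |conjMatrix θ k l| * ‖γ k - γ l‖
      ≤ θ ^ (2 * (k - l).natAbs) * (intWeight k * intWeight (k - l)) * ‖γ k - γ l‖ := by
        gcongr
        exact abs_conjMatrix_le h0 k l
    _ = θ ^ (2 * (k - l).natAbs) * intWeight (k - l) * (intWeight k ^ 1 * ‖γ k - γ l‖) := by ring
    _ ≤ θ ^ (k - l).natAbs * intWeight (k - l) * (C * intWeight (k - l) ^ (2 * 1 + 1)) := by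
        have := pow_two_mul_natAbs_le h0 h1 (k - l)
        gcongr
    _ = _ := by ring

/-- The `j`-th term of the `(k, l)` entry of the second commutator. -/
def commMatrixTerm (θ : ℝ) (γ : ℤ → ℂ) (k l j : ℤ) : ℂ :=
  conjMatrix θ k j * commMatrix θ γ j l - commMatrix θ γ k j * conjMatrix θ j l

/-- Cancellation between the terms of the second commutator at `j` and at its reflection
`k + l - j`. -/
lemma norm_weighted_reflection_le {γ : ℤ → ℂ} {C₁ C₂ : ℝ}
    (h1 : ∀ k, intWeight k ^ 1 * ‖γ k - γ (k + 1)‖ ≤ C₁)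
    (h2 : ∀ k, intWeight k ^ 2 * ‖γ k - 2 * γ (k + 1) + γ (k + 2)‖ ≤ C₂) (k l j : ℤ) :
    ‖((k : ℂ) + j) * (j + l) * (γ k + γ l - 2 * γ j) +
      ((k : ℂ) + (k + l - j : ℤ)) * ((k + l - j : ℤ) + l) * (γ k + γ l - 2 * γ (k + l - j))‖ ≤
      (16 * C₁ + 8 * C₂) * (intWeight (k - j) ^ 7 * intWeight (j - l) ^ 7) := by
  have hW := intWeight_pos
  have hQ := weighted_mixed_sub_le h2 k j l
  have hK := weighted_sub_le h1 k (k + l - j)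
  have hL := weighted_sub_le h1 l (k + l - j)
  rw [show k - (k + l - j) = j - l by ring] at hK
  rw [show l - (k + l - j) = j - k by ring, intWeight_sub_comm j k] at hL
  have hC₁ : 0 ≤ C₁ := le_trans (by have := hW k; positivity) (h1 k)
  have hC₂ : 0 ≤ C₂ := le_trans (by have := hW k; positivity) (h2 k)
  have hkj := abs_add_le_intWeight k j
  have hjl := abs_add_le_intWeight l j
  have hkl := abs_add_le_intWeight k l
  have hlk := abs_add_le_intWeight l k
  have hkl' := intWeight_add_le (k - j) (j - l)
  rw [show k - j + (j - l) = k - l by ring] at hkl'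
  have hlW := intWeight_le_mul_sub l k
  rw [intWeight_sub_comm l k] at hlW hlk
  rw [intWeight_sub_comm l j] at hjl
  have hdiff : |((k - j : ℤ) : ℝ) - (j - l : ℤ)| ≤ 2 * (intWeight (k - j) * intWeight (j - l)) := by
    have e1 := abs_sub ((k - j : ℤ) : ℝ) (j - l : ℤ)
    have e2 := abs_le_intWeight (k - j)
    have e3 := abs_le_intWeight (j - l)
    have e4 := one_le_intWeight (k - j)
    have e5 := one_le_intWeight (j - l)
    nlinarith
  have hx1 := one_le_intWeight (k - j)
  have hy1 := one_le_intWeight (j - l)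
  have hk := hW k
  have hl := hW l
  have hx := hW (k - j)
  have hy := hW (j - l)
  generalize intWeight (k - j) = x at *
  generalize intWeight (j - l) = y at *
  have first : ‖((k : ℂ) + j) * (l + j) * (γ k + γ l - γ j - γ (k + l - j))‖ ≤
      4 * C₂ * (x ^ 7 * y ^ 7) := by
    have e1 : ‖(k : ℂ) + j‖ ≤ 2 * (intWeight k * x) := by
      rw [← Int.cast_add, Complex.norm_intCast, Int.cast_add]; exact hkj
    have e2 : ‖(l : ℂ) + j‖ ≤ 2 * (intWeight k * (x * y) * y) := by
      rw [← Int.cast_add, Complex.norm_intCast, Int.cast_add]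
      refine hjl.trans ?_
      gcongr
      exact hlW.trans (by gcongr)
    rw [norm_mul, norm_mul]
    calc _ ≤ 2 * (intWeight k * x) * (2 * (intWeight k * (x * y) * y)) *
          ‖γ k + γ l - γ j - γ (k + l - j)‖ := by gcongr
      _ = 4 * x ^ 2 * y ^ 2 * (intWeight k ^ 2 * ‖γ k + γ l - γ j - γ (k + l - j)‖) := by ring
      _ ≤ 4 * x ^ 2 * y ^ 2 * (C₂ * x ^ 5 * y ^ 5) := by gcongr
      _ = _ := by ring
  have second : ‖(k : ℂ) + l‖ * ‖γ k - γ (k + l - j)‖ ≤ 2 * C₁ * (x ^ 6 * y ^ 6) := by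
    rw [← Int.cast_add, Complex.norm_intCast, Int.cast_add]
    calc _ ≤ 2 * (intWeight k * (x * y)) * ‖γ k - γ (k + l - j)‖ := by
          gcongr
          exact hkl.trans (by gcongr)
      _ = 2 * (x * y) * (intWeight k ^ 1 * ‖γ k - γ (k + l - j)‖) := by ring
      _ ≤ 2 * (x * y) * (C₁ * y ^ (2 * 1 + 1)) := by gcongr
      _ = 2 * C₁ * (x ^ 1 * y ^ 4) := by ring
      _ ≤ _ := by gcongr <;> first | assumption | norm_num
  have third : ‖(k : ℂ) + l‖ * ‖γ l - γ (k + l - j)‖ ≤ 2 * C₁ * (x ^ 6 * y ^ 6) := by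
    rw [add_comm (k : ℂ), ← Int.cast_add, Complex.norm_intCast, Int.cast_add]
    calc _ ≤ 2 * (intWeight l * (x * y)) * ‖γ l - γ (k + l - j)‖ := by
          gcongr
          exact hlk.trans (by gcongr)
      _ = 2 * (x * y) * (intWeight l ^ 1 * ‖γ l - γ (k + l - j)‖) := by ring
      _ ≤ 2 * (x * y) * (C₁ * x ^ (2 * 1 + 1)) := by gcongr
      _ = 2 * C₁ * (x ^ 4 * y ^ 1) := by ring
      _ ≤ _ := by gcongr <;> first | assumption | norm_num
  have hdiff' : ‖((k - j : ℤ) : ℂ) - (j - l : ℤ)‖ ≤ 2 * (x * y) := by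
    rw [← Int.cast_sub, Complex.norm_intCast, Int.cast_sub]; exact hdiff
  have fourth : ‖(((k - j : ℤ) : ℂ) - (j - l : ℤ)) * (((k : ℂ) + l) * (γ k - γ (k + l - j)) +
      ((k : ℂ) + l) * (γ l - γ (k + l - j)))‖ ≤ 8 * C₁ * (x ^ 7 * y ^ 7) := by
    have h := norm_add_le (((k : ℂ) + l) * (γ k - γ (k + l - j)))
      (((k : ℂ) + l) * (γ l - γ (k + l - j)))
    rw [norm_mul, norm_mul] at h
    rw [norm_mul]
    calc _ ≤ 2 * (x * y) * (2 * C₁ * (x ^ 6 * y ^ 6) + 2 * C₁ * (x ^ 6 * y ^ 6)) := by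
          gcongr
          linarith
      _ = _ := by ring
  have split : ((k : ℂ) + j) * (j + l) * (γ k + γ l - 2 * γ j) +
      ((k : ℂ) + (k + l - j : ℤ)) * ((k + l - j : ℤ) + l) * (γ k + γ l - 2 * γ (k + l - j)) =
      2 * (((k : ℂ) + j) * (l + j) * (γ k + γ l - γ j - γ (k + l - j))) +
      2 * ((((k - j : ℤ) : ℂ) - (j - l : ℤ)) * (((k : ℂ) + l) * (γ k - γ (k + l - j)) +
      ((k : ℂ) + l) * (γ l - γ (k + l - j)))) := by
    push_cast
    ring
  rw [split]
  refine (norm_add_le _ _).trans ?_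
  rw [norm_mul 2, norm_mul 2, Complex.norm_ofNat]
  linarith

lemma norm_commMatrixTerm_add_reflection_le {θ : ℝ} (h0 : 0 ≤ θ) (hθ : θ ≤ 1) {γ : ℤ → ℂ}
    {C₁ C₂ : ℝ} (h1 : ∀ k, intWeight k ^ 1 * ‖γ k - γ (k + 1)‖ ≤ C₁)
    (h2 : ∀ k, intWeight k ^ 2 * ‖γ k - 2 * γ (k + 1) + γ (k + 2)‖ ≤ C₂) (k l j : ℤ) :
    ‖commMatrixTerm θ γ k l j + commMatrixTerm θ γ k l (k + l - j)‖ ≤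
      (4 * C₁ + 2 * C₂) * θ ^ (k - l).natAbs *
        ((intWeight (k - j) ^ 7 * θ ^ (k - j).natAbs) *
          (intWeight (j - l) ^ 7 * θ ^ (j - l).natAbs)) := by
  have hx := intWeight_pos (k - j)
  have hy := intWeight_pos (j - l)
  have hC₁ : 0 ≤ C₁ := le_trans (by have := intWeight_pos k; positivity) (h1 k)
  have hC₂ : 0 ≤ C₂ := le_trans (by have := intWeight_pos k; positivity) (h2 k)
  have hR : 0 ≤ (4 * C₁ + 2 * C₂) * θ ^ (k - l).natAbs *
        ((intWeight (k - j) ^ 7 * θ ^ (k - j).natAbs) *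
          (intWeight (j - l) ^ 7 * θ ^ (j - l).natAbs)) := by positivity
  by_cases hkj : k = j
  · subst hkj
    simpa [commMatrixTerm, commMatrix, conjMatrix] using hR
  by_cases hjl : j = l
  · subst hjl
    simpa [commMatrixTerm, commMatrix, conjMatrix] using hR
  have hval : commMatrixTerm θ γ k l j + commMatrixTerm θ γ k l (k + l - j) =
      ((1 / 4 * (θ ^ (2 * (k - j).natAbs) * θ ^ (2 * (j - l).natAbs)) : ℝ) : ℂ) *
      (((k : ℂ) + j) * (j + l) * (γ k + γ l - 2 * γ j) +
      ((k : ℂ) + (k + l - j : ℤ)) * ((k + l - j : ℤ) + l) * (γ k + γ l - 2 * γ (k + l - j))) := by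
    simp only [commMatrixTerm, commMatrix, conjMatrix]
    rw [if_neg hkj, if_neg hjl, if_neg (by omega), if_neg (by omega),
      show k - (k + l - j) = j - l by ring, show k + l - j - l = k - j by ring]
    push_cast
    ring
  have hexp : θ ^ (2 * (k - j).natAbs) * θ ^ (2 * (j - l).natAbs) ≤
      θ ^ (k - l).natAbs * (θ ^ (k - j).natAbs * θ ^ (j - l).natAbs) := by
    rw [← pow_add, ← pow_add, ← pow_add]
    exact pow_le_pow_of_le_one h0 hθ (by omega)
  rw [hval, norm_mul, Complex.norm_real, Real.norm_of_nonneg (by positivity)]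
  calc _ ≤ 1 / 4 * (θ ^ (k - l).natAbs * (θ ^ (k - j).natAbs * θ ^ (j - l).natAbs)) *
        ((16 * C₁ + 8 * C₂) * (intWeight (k - j) ^ 7 * intWeight (j - l) ^ 7)) := by
        gcongr
        exact norm_weighted_reflection_le h1 h2 k l j
    _ = _ := by ring

lemma norm_tsum_le_of_equiv {ι : Type*} {f : ι → ℂ} {g : ι → ℝ} (e : ι ≃ ι) (hg : Summable g)
    (h : ∀ i, ‖f i + f (e i)‖ ≤ g i) : ‖∑' i, f i‖ ≤ ∑' i, g i := by
  have hG : 0 ≤ ∑' i, g i := tsum_nonneg fun i => (norm_nonneg _).trans (h i)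
  by_cases hf : Summable f
  · have h1 := tsum_of_norm_bounded hg.hasSum h
    have h2 := hf.tsum_add ((e.summable_iff (f := f)).2 hf)
    simp only [Function.comp_apply] at h2
    rw [h2, e.tsum_eq f, ← two_mul, norm_mul,
      Complex.norm_ofNat] at h1
    linarith [norm_nonneg (∑' i, f i)]
  · rwa [tsum_eq_zero_of_not_summable hf, norm_zero]

lemma exists_norm_tsum_commMatrixTerm_le {θ : ℝ} (h0 : 0 ≤ θ) (hθ : θ < 1) {γ : ℤ → ℂ}
    {C₁ C₂ : ℝ} (h1 : ∀ k, intWeight k ^ 1 * ‖γ k - γ (k + 1)‖ ≤ C₁)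
    (h2 : ∀ k, intWeight k ^ 2 * ‖γ k - 2 * γ (k + 1) + γ (k + 2)‖ ≤ C₂) :
    ∃ C, ∀ k l, ‖∑' j, commMatrixTerm θ γ k l j‖ ≤ C * θ ^ (k - l).natAbs := by
  have hs := summable_intWeight_pow_mul_geometric h0 hθ 7
  have hs0 : ∀ m, 0 ≤ intWeight m ^ 7 * θ ^ m.natAbs := fun m => by
    have := intWeight_pos m
    positivity
  have hpair := norm_commMatrixTerm_add_reflection_le h0 hθ.le h1 h2
  obtain ⟨s, hs_def⟩ : ∃ s : ℤ → ℝ, ∀ m, s m = intWeight m ^ 7 * θ ^ m.natAbs :=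
    ⟨_, fun _ => rfl⟩
  simp only [← hs_def] at hs hs0 hpair
  have hC₁ : 0 ≤ C₁ := le_trans (by have := intWeight_pos 0; positivity) (h1 0)
  have hC₂ : 0 ≤ C₂ := le_trans (by have := intWeight_pos 0; positivity) (h2 0)
  refine ⟨(4 * C₁ + 2 * C₂) * ((∑' m, s m) * ∑' m, s m), fun k l => ?_⟩
  have hsum : Summable fun j => s (k - j) := (Equiv.subLeft k).summable_iff.2 hs
  have hval : ∑' j, s (k - j) = ∑' m, s m := (Equiv.subLeft k).tsum_eq s
  refine (norm_tsum_le_of_equiv (Equiv.subLeft (k + l))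
    (g := fun j => (4 * C₁ + 2 * C₂) * θ ^ (k - l).natAbs * (∑' m, s m) * s (k - j))
    (hsum.mul_left _) fun j => ?_).trans_eq ?_
  · refine (hpair k l j).trans ?_
    have hle : s (j - l) ≤ ∑' m, s m := hs.le_tsum _ fun m _ => hs0 m
    have := hs0 (k - j)
    calc _ ≤ (4 * C₁ + 2 * C₂) * θ ^ (k - l).natAbs * (s (k - j) * ∑' m, s m) := by gcongr
      _ = _ := by ring
  · rw [tsum_mul_left, hval]
    ring

/-- The conjugate operator factors through the weight: on its domain it is a bounded operator
applied to the weighted vector. -/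
lemma exists_conj_factorization {θ : ℝ} (h0 : 0 ≤ θ) (hθ : θ < 1) :
    ∃ R T : l2Z →L[ℂ] l2Z, (∀ φ k, R φ k = ((intWeight k)⁻¹ : ℝ) * φ k) ∧
      (∀ k l, T (l2Z.basisVec l) k = conjMatrix θ k l * ((intWeight l)⁻¹ : ℝ)) ∧
      ∀ φ : l2Z, (Summable fun k : ℤ => (1 + (k : ℝ) ^ 2) * ‖φ k‖ ^ 2) →
        ∃ u : l2Z, φ = R u ∧ ∀ k, T u k = ∑' j, (conjMatrix θ k j : ℂ) * φ j := by
  obtain ⟨R, -, hR⟩ := l2Z.exists_weightedShift (c := fun k => ((intWeight k)⁻¹ : ℝ)) (M := 1)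
    (fun k => by
      rw [Complex.norm_real, Real.norm_of_nonneg (inv_nonneg.2 (intWeight_pos k).le)]
      exact inv_le_one_of_one_le₀ (one_le_intWeight k)) 0
  obtain ⟨T, hT⟩ := l2Z.exists_clm_of_matrix
    (K := fun k l => (conjMatrix θ k l : ℂ) * ((intWeight l)⁻¹ : ℝ))
    (summable_intWeight_pow_mul_geometric h0 hθ 1) (fun k l => by
      have hl := intWeight_pos l
      have hkl := intWeight_pos (l - k)
      rw [norm_mul, Complex.norm_real, Complex.norm_real, Real.norm_eq_abs,
        Real.norm_of_nonneg (inv_nonneg.2 hl.le), conjMatrix_symm, ← div_eq_mul_inv,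
        div_le_iff₀ hl]
      refine (abs_conjMatrix_le h0 l k).trans ?_
      rw [show (k - l).natAbs = (l - k).natAbs by omega, intWeight_sub_comm k l]
      calc _ ≤ θ ^ (l - k).natAbs * (intWeight l * intWeight (l - k)) :=
            mul_le_mul_of_nonneg_right (pow_two_mul_natAbs_le h0 hθ.le _) (by positivity)
        _ = _ := by ring)
  refine ⟨R, T, fun φ k => by simpa using hR φ k, hT, fun φ hφ => ?_⟩
  have hmem : Memℓp (fun k : ℤ => (intWeight k : ℂ) * φ k) 2 := by
    refine memℓp_gen (Summable.of_nonneg_of_le (fun k => by positivity) (fun k => ?_)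
      (hφ.mul_left 2))
    rw [norm_mul, Complex.norm_real, Real.norm_of_nonneg (intWeight_pos k).le,
      ENNReal.toReal_ofNat, Real.rpow_ofNat, mul_pow, ← mul_assoc]
    gcongr
    rw [intWeight]
    nlinarith [sq_nonneg (1 - |(k : ℝ)|), sq_abs (k : ℝ)]
  have hne : ∀ k, (intWeight k : ℂ) ≠ 0 := fun k => by
    exact_mod_cast (intWeight_pos k).ne'
  refine ⟨⟨_, hmem⟩, ?_, fun k => ?_⟩
  · ext k
    rw [hR]
    simp [hne k]
  · rw [← (l2Z.hasSum_matrix T _ k).tsum_eq]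
    refine tsum_congr fun j => ?_
    rw [hT]
    simp [hne j, mul_assoc]

/-- Proposition 3.4 ("criteria2"): for `a > 1`, if `q₂(γ) < ∞` then the diagonal operator
`D_γ` is of class `C²(A_a)`: there are bounded operators `B₁, B₂` with
`⟨A_aφ, D_γψ⟩ − ⟨φ, D_γ(A_aψ)⟩ = ⟨φ, B₁ψ⟩` and
`⟨A_aφ, B₁ψ⟩ − ⟨φ, B₁(A_aψ)⟩ = ⟨φ, B₂ψ⟩` for all `φ, ψ ∈ D_X`. -/
theorem stmt4 (a : ℝ) (ha : 1 < a) (γ : ℤ → ℂ)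
    -- q₂(γ) < ∞ : γ, k·(Δγ) and k²·(Δ²γ) are bounded
    (hq0 : BddAbove (Set.range fun k : ℤ => ‖γ k‖))
    (hq1 : BddAbove (Set.range fun k : ℤ => ‖(k : ℂ) * (γ k - γ (k + 1))‖))
    (hq2 : BddAbove (Set.range fun k : ℤ =>
      ‖(k : ℂ) ^ 2 * (γ k - 2 * γ (k + 1) + γ (k + 2))‖))
    -- the conjugate operator A_a, with domain D_X and the prescribed action
    (Aa : l2Z →ₗ.[ℂ] l2Z)
    (hdom : ∀ φ : l2Z,
      φ ∈ Aa.domain ↔ Summable fun k : ℤ => (1 + (k : ℝ) ^ 2) * ‖φ k‖ ^ 2)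
    (haction : ∀ (φ : l2Z) (hφ : φ ∈ Aa.domain) (k : ℤ),
      (Aa ⟨φ, hφ⟩ : l2Z) k = (1 / 2 : ℂ) * ∑' m : ℤ,
        (if m = 0 then 0 else
          ((a ^ (-|m|) : ℝ) : ℂ) * (2 * (k : ℂ) - (m : ℂ)) * φ (k - m)))
    -- Dγ the diagonal operator associated to γ
    (Dγ : l2Z →L[ℂ] l2Z)
    (hDγ : ∀ (φ : l2Z) (k : ℤ), (Dγ φ) k = γ k * φ k) :
    ∃ B₁ B₂ : l2Z →L[ℂ] l2Z,
      (∀ φ ψ : Aa.domain,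
        ⟪Aa φ, Dγ (ψ : l2Z)⟫ - ⟪(φ : l2Z), Dγ (Aa ψ)⟫ = ⟪(φ : l2Z), B₁ (ψ : l2Z)⟫) ∧
      (∀ φ ψ : Aa.domain,
        ⟪Aa φ, B₁ (ψ : l2Z)⟫ - ⟪(φ : l2Z), B₁ (Aa ψ)⟫ = ⟪(φ : l2Z), B₂ (ψ : l2Z)⟫) := by
  obtain ⟨M₀, hM₀⟩ := hq0
  obtain ⟨M₁, hM₁⟩ := hq1
  obtain ⟨M₂, hM₂⟩ := hq2
  replace hM₀ : ∀ k, ‖γ k‖ ≤ M₀ := fun k => hM₀ ⟨k, rfl⟩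
  replace hM₁ : ∀ k : ℤ, ‖(k : ℂ) * (γ k - γ (k + 1))‖ ≤ M₁ := fun k => hM₁ ⟨k, rfl⟩
  replace hM₂ : ∀ k : ℤ, ‖(k : ℂ) ^ 2 * (γ k - 2 * γ (k + 1) + γ (k + 2))‖ ≤ M₂ :=
    fun k => hM₂ ⟨k, rfl⟩
  have h1 := exists_weighted_bound (u := fun k => γ k - γ (k + 1)) (p := 1) (M := M₀ + M₀)
    (fun k => (norm_sub_le _ _).trans (add_le_add (hM₀ _) (hM₀ _)))
    (fun k => by simpa only [pow_one] using hM₁ k)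
  have h2 := exists_weighted_bound (u := fun k => γ k - 2 * γ (k + 1) + γ (k + 2)) (p := 2)
    (M := M₀ + 2 * M₀ + M₀) (fun k => by
      refine (norm_add_le _ _).trans (add_le_add ((norm_sub_le _ _).trans ?_) (hM₀ _))
      rw [norm_mul, Complex.norm_ofNat]
      exact add_le_add (hM₀ _) (mul_le_mul_of_nonneg_left (hM₀ _) two_pos.le)) hM₂
  have ha0 : 0 < a := one_pos.trans ha
  set θ : ℝ := √a⁻¹ with hθ_def
  have h0 : 0 ≤ θ := Real.sqrt_nonneg _
  have hθ : θ < 1 := by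
    rw [hθ_def, Real.sqrt_lt' one_pos, one_pow]
    exact inv_lt_one_of_one_lt₀ ha
  have hpow : ∀ m : ℤ, a ^ (-|m|) = θ ^ (2 * m.natAbs) := fun m => by
    rw [pow_mul, hθ_def, Real.sq_sqrt (inv_nonneg.2 ha0.le), zpow_neg, Int.abs_eq_natAbs,
      zpow_natCast, inv_pow]
  have hA : ∀ (φ : l2Z) (hφ : φ ∈ Aa.domain) (k : ℤ),
      (Aa ⟨φ, hφ⟩ : l2Z) k = ∑' j, (conjMatrix θ k j : ℂ) * φ j := fun φ hφ k => by
    rw [haction, ← tsum_mul_left, ← (Equiv.subLeft k).tsum_eq]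
    refine tsum_congr fun j => ?_
    rw [Equiv.subLeft_apply, conjMatrix, hpow]
    by_cases h : k = j
    · simp [h]
    · rw [if_neg (sub_ne_zero.2 h), if_neg h, sub_sub_cancel]
      push_cast
      ring
  obtain ⟨R, T, hR, hT, hfactor⟩ := exists_conj_factorization h0 hθ
  have hRT : ∀ φ : Aa.domain, ∃ u : l2Z, (φ : l2Z) = R u ∧ Aa φ = T u := by
    rintro ⟨φ, hφ⟩
    obtain ⟨u, hu, hTu⟩ := hfactor φ ((hdom φ).1 hφ)
    refine ⟨u, hu, ?_⟩
    ext k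
    rw [hA, hTu]
  have hcomm : ∀ B C : l2Z →L[ℂ] l2Z, (∀ k l, C (l2Z.basisVec l) k =
      ∑' j, ((conjMatrix θ k j : ℂ) * B (l2Z.basisVec l) j -
        B (l2Z.basisVec j) k * conjMatrix θ j l)) → ∀ φ ψ : Aa.domain,
      ⟪Aa φ, B (ψ : l2Z)⟫ - ⟪(φ : l2Z), B (Aa ψ)⟫ = ⟪(φ : l2Z), C (ψ : l2Z)⟫ := by
    intro B C hC φ ψ
    obtain ⟨u, hu, hTu⟩ := hRT φ
    obtain ⟨v, hv, hTv⟩ := hRT ψ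
    rw [hu, hv, hTu, hTv]
    exact l2Z.inner_commutator (conjMatrix_symm θ) hR hT hC u v
  obtain ⟨B₁, hB₁⟩ := l2Z.exists_clm_of_matrix
    ((summable_intWeight_pow_mul_geometric h0 hθ 4).mul_left _) (norm_commMatrix_le h0 hθ.le h1)
  obtain ⟨C, hC⟩ := exists_norm_tsum_commMatrixTerm_le h0 hθ h1 h2
  obtain ⟨B₂, hB₂⟩ := l2Z.exists_clm_of_matrix (w := fun m => C * θ ^ m.natAbs)
    (by simpa using (summable_intWeight_pow_mul_geometric h0 hθ 0).mul_left C) hC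
  refine ⟨B₁, B₂, hcomm Dγ B₁ fun k l => ?_, hcomm B₁ B₂ fun k l => ?_⟩
  · have hsum := (hasSum_ite_eq l ((conjMatrix θ k l : ℂ) * γ l)).sub
      (hasSum_ite_eq k (γ k * conjMatrix θ k l))
    rw [hB₁, commMatrix, mul_sub, mul_comm _ (γ k), ← hsum.tsum_eq]
    refine tsum_congr fun j => ?_
    rw [hDγ, hDγ, l2Z.basisVec_apply, l2Z.basisVec_apply]
    congr 1
    · split_ifs with h <;> simp [h]
    · simp only [eq_comm (a := k)]
      split_ifs with h <;> simp [h]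
  · rw [hB₂]
    simp only [hB₁, commMatrixTerm]
end
end

section
/- Let d ∈ ℕ, α ∈ ℤ^d \ {0}, and let A be the self-adjoint operator on ℓ²(ℤ^d) of multiplication by α·β (i.e. A e_β = (Σ_j α_j β_j) e_β) with its maximal domain D(A). Let U be a unitary operator on ℓ²(ℤ^d) of class C¹(A) with commutator B_U, and assume that the bounded operator T^{−α}B_U − |α|²·T^{−α}U (which represents the commutator of A with T^{−α}U) is compact, where |α|² = Σ_j α_j². Then U has at most finitely many eigenvalues, and each eigenspace of U is finite-dimensional. -/
open scoped ComplexInnerProductSpace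

noncomputable section

/-- `ℓ²(ℤ^d)`. -/
abbrev l2Zd (d : ℕ) : Type := lp (fun _ : (Fin d → ℤ) => ℂ) 2

open Filter Topology

/-- Multiplying a square-summable family by multipliers bounded by one that tend pointwise to `1`
gives families converging to the original one. -/
theorem tendsto_lp_two_of_multipliers {ι : Type*} (f : lp (fun _ : ι => ℂ) 2)
    (m : ℕ → ι → ℂ) (hm : ∀ n i, ‖m n i‖ ≤ 1) (hm1 : ∀ i, Tendsto (fun n => m n i) atTop (𝓝 1))
    (g : ℕ → lp (fun _ : ι => ℂ) 2) (hg : ∀ n i, g n i = m n i * f i) :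
    Tendsto g atTop (𝓝 f) := by
  have hsq (h : lp (fun _ : ι => ℂ) 2) : ‖h‖ ^ 2 = ∑' i, ‖h i‖ ^ 2 := by
    have := lp.norm_rpow_eq_tsum (p := 2) (by norm_num) h
    simpa using this
  have hsum : Summable fun i => ‖f i‖ ^ 2 := by
    simpa using (lp.memℓp f).summable (by norm_num)
  have hlim : Tendsto (fun n => ∑' i, ‖(g n - f) i‖ ^ 2) atTop (𝓝 (∑' _ : ι, (0 : ℝ))) := by
    refine tendsto_tsum_of_dominated_convergence (bound := fun i => 4 * ‖f i‖ ^ 2)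
      (hsum.mul_left 4) (fun i => ?_) (Eventually.of_forall fun n i => ?_)
    · have h0 : Tendsto (fun n => ‖m n i * f i - f i‖ ^ 2) atTop (𝓝 (‖1 * f i - f i‖ ^ 2)) :=
        ((((hm1 i).mul_const _).sub_const _).norm).pow 2
      simpa [hg] using h0
    · have h1 : (g n - f) i = (m n i - 1) * f i := by
        rw [lp.coeFn_sub, Pi.sub_apply, hg]; ring
      have h2 : ‖m n i - 1‖ ≤ 2 :=
        (norm_sub_le _ _).trans (by have := hm n i; simp only [norm_one]; linarith)
      rw [h1, norm_mul, mul_pow, Real.norm_of_nonneg (by positivity)]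
      have h3 : ‖m n i - 1‖ ^ 2 ≤ 2 ^ 2 := by gcongr
      nlinarith [sq_nonneg ‖f i‖]
  rw [tsum_zero] at hlim
  simp only [← hsq] at hlim
  rw [tendsto_iff_norm_sub_tendsto_zero]
  have := hlim.sqrt
  simpa [Real.sqrt_sq] using this

/-- A compact operator `K` cannot have constant nonzero matrix elements `⟪V eₙ, K eₙ⟫` along an
orthonormal sequence, when `V` preserves inner products. -/
theorem not_exists_orthonormal_inner_compact_eq {H : Type*} [NormedAddCommGroup H]
    [InnerProductSpace ℂ H] (V K : H →L[ℂ] H) (hV : ∀ x y, ⟪V x, V y⟫ = ⟪x, y⟫)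
    (hK : IsCompactOperator K) {a : ℂ} (ha : a ≠ 0) (e : ℕ → H) (he : Orthonormal ℂ e)
    (h : ∀ n, ⟪V (e n), K (e n)⟫ = a) : False := by
  obtain ⟨C, hC, hsub⟩ := hK.image_subset_compact_of_bounded (S := Metric.closedBall 0 1)
    Metric.isBounded_closedBall
  obtain ⟨y, -, φ, hφ, hy⟩ := hC.tendsto_subseq (x := fun n => K (e n)) fun n =>
    hsub ⟨e n, by simp [he.1 n], rfl⟩
  have hVe : Orthonormal ℂ fun n => V (e n) :=
    (orthonormal_iff_ite.2 fun i j => by rw [hV]; exact orthonormal_iff_ite.1 he i j)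
  have h0 : Tendsto (fun n => ⟪V (e (φ n)), y⟫) atTop (𝓝 0) := by
    have := (hVe.inner_products_summable y).tendsto_atTop_zero.sqrt.comp hφ.tendsto_atTop
    rw [tendsto_zero_iff_norm_tendsto_zero]
    simpa [Function.comp_def, Real.sqrt_sq] using this
  have h1 : Tendsto (fun n => ⟪V (e (φ n)), K (e (φ n)) - y⟫) atTop (𝓝 0) := by
    refine squeeze_zero_norm (fun n => norm_inner_le_norm _ _) ?_
    have := tendsto_iff_norm_sub_tendsto_zero.1 hy
    simpa [hVe.1] using this
  have h2 := h1.add h0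
  simp only [← inner_add_right, sub_add_cancel, h, add_zero] at h2
  exact ha (tendsto_nhds_unique tendsto_const_nhds h2)

/-- Eigenvalues of an operator preserving inner products have modulus one. -/
theorem conj_mul_self_eq_one_of_eigenvector {H : Type*} [NormedAddCommGroup H]
    [InnerProductSpace ℂ H] {U : H →ₗ[ℂ] H} (hU : ∀ x y, ⟪U x, U y⟫ = ⟪x, y⟫) {x : H} (hx : x ≠ 0)
    {c : ℂ} (hc : U x = c • x) : (starRingEnd ℂ) c * c = 1 := by
  have := hU x x
  rw [hc, inner_smul_left, inner_smul_right, ← mul_assoc] at this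
  exact mul_right_cancel₀ (inner_self_ne_zero.2 hx) (by rw [this, one_mul])

/-- An operator preserving inner products has finitely many eigenvalues, with finite-dimensional
eigenspaces, as soon as its eigenvectors contain no orthonormal sequence. -/
theorem finite_eigenvalues_of_no_orthonormal_eigenvectors {H : Type*} [NormedAddCommGroup H]
    [InnerProductSpace ℂ H] (U : H →ₗ[ℂ] H) (hU : ∀ x y, ⟪U x, U y⟫ = ⟪x, y⟫)
    (h : ∀ e : ℕ → H, Orthonormal ℂ e → ¬ ∀ n, ∃ c : ℂ, U (e n) = c • e n) :
    {c : ℂ | Module.End.HasEigenvalue U c}.Finite ∧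
      ∀ c : ℂ, FiniteDimensional ℂ (Module.End.eigenspace U c) := by
  constructor
  · by_contra hinf
    let c := (show {c : ℂ | Module.End.HasEigenvalue U c}.Infinite from hinf).natEmbedding
    have hex (n : ℕ) : ∃ x : H, ‖x‖ = 1 ∧ U x = (c n : ℂ) • x := by
      obtain ⟨v, hv⟩ := (c n).2.exists_hasEigenvector
      refine ⟨((‖v‖⁻¹ : ℝ) : ℂ) • v, ?_, ?_⟩
      · have := norm_ne_zero_iff.2 hv.2
        rw [norm_smul]; simp [this]
      · rw [map_smul, hv.apply_eq_smul, smul_comm]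
    choose e he1 he using hex
    refine h e ⟨he1, fun i j hij => ?_⟩ fun n => ⟨c n, he n⟩
    by_contra hne
    have hi : (starRingEnd ℂ) (c i : ℂ) * c i = 1 :=
      conj_mul_self_eq_one_of_eigenvector hU (norm_ne_zero_iff.1 (by simp [he1])) (he i)
    have hj : (starRingEnd ℂ) (c i : ℂ) * c j = 1 := by
      have := hU (e i) (e j)
      rw [he, he, inner_smul_left, inner_smul_right, ← mul_assoc] at this
      exact mul_right_cancel₀ hne (by rw [this, one_mul])
    have hc : (starRingEnd ℂ) (c i : ℂ) ≠ 0 := left_ne_zero_of_mul_eq_one hi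
    exact hij (c.injective (Subtype.ext (mul_left_cancel₀ hc (hi.trans hj.symm))))
  · intro c
    by_contra hfin
    let b := Module.Basis.ofVectorSpace ℂ (Module.End.eigenspace U c)
    have hinf : Infinite (Module.Basis.ofVectorSpaceIndex ℂ (Module.End.eigenspace U c)) := by
      by_contra hf
      rw [not_infinite_iff_finite] at hf
      exact hfin (Module.Finite.of_basis b)
    have hli := b.linearIndependent.comp _ (Infinite.natEmbedding _).injective
    have hon := InnerProductSpace.gramSchmidtNormed_orthonormal (𝕜 := ℂ) hli
    exact h _ (hon.comp_linearIsometry (Module.End.eigenspace U c).subtypeₗᵢ) fun n =>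
      ⟨c, Module.End.mem_eigenspace_iff.1 (Subtype.prop _)⟩

/-- Virial theorem: the commutator of the multiplication operator by a real function `a` with an
inner-product preserving operator `U` has vanishing expectation in eigenvectors of `U`. -/
theorem inner_commutator_eigenvector_eq_zero {ι : Type*} (a : ι → ℤ)
    (U B : lp (fun _ : ι => ℂ) 2 →L[ℂ] lp (fun _ : ι => ℂ) 2)
    (hU : ∀ x y, ⟪U x, U y⟫ = ⟪x, y⟫)
    (hC1 : ∀ φ ψ Aφ Aψ : lp (fun _ : ι => ℂ) 2, (∀ i, Aφ i = (a i : ℂ) * φ i) →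
      (∀ i, Aψ i = (a i : ℂ) * ψ i) → ⟪Aφ, U ψ⟫ - ⟪φ, U Aψ⟫ = ⟪φ, B ψ⟫)
    {φ : lp (fun _ : ι => ℂ) 2} {c : ℂ} (hφ : U φ = c • φ) : ⟪φ, B φ⟫ = 0 := by
  rcases eq_or_ne φ 0 with rfl | hφ0
  · simp
  have hcc : (starRingEnd ℂ) c * c = 1 :=
    conj_mul_self_eq_one_of_eigenvector (U := (U : _ →ₗ[ℂ] _)) hU hφ0 hφ
  have hadj (y : lp (fun _ : ι => ℂ) 2) : ⟪φ, U y⟫ = c * ⟪φ, y⟫ := by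
    have := hU φ y
    rw [hφ, inner_smul_left] at this
    rw [← this, ← mul_assoc, mul_comm c, hcc, one_mul]
  let ε : ℕ → ℝ := fun n => 1 / ((n : ℝ) + 1)
  have hε (n : ℕ) : ε n ≠ 0 := by positivity
  let z : ℝ → ι → ℂ := fun t i => 1 + Complex.I * (t * a i : ℝ)
  have hre (t : ℝ) (i : ι) : (z t i).re = 1 := by simp [z]
  have hz (t : ℝ) (i : ι) : z t i ≠ 0 := fun h => by simpa [h] using hre t i
  have hz1 (t : ℝ) (i : ι) : ‖(z t i)⁻¹‖ ≤ 1 := by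
    rw [norm_inv]
    refine inv_le_one_of_one_le₀ ?_
    simpa [hre] using (Complex.abs_re_le_norm (z t i))
  have hmem (t : ℝ) : Memℓp (fun i => (z t i)⁻¹ * φ i) 2 :=
    (lp.memℓp φ).mono' fun i => by
      rw [norm_mul]; exact mul_le_of_le_one_left (norm_nonneg _) (hz1 t i)
  let ψ : ℝ → lp (fun _ : ι => ℂ) 2 := fun t => ⟨_, hmem t⟩
  have hψ (t : ℝ) (i : ι) : ψ t i = (z t i)⁻¹ * φ i := rfl
  have hA (t : ℝ) (ht : t ≠ 0) (i : ι) :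
      ((Complex.I * t)⁻¹ • (φ - ψ t)) i = (a i : ℂ) * ψ t i := by
    have ht' : (t : ℂ) ≠ 0 := by exact_mod_cast ht
    have := hz t i
    rw [lp.coeFn_smul, Pi.smul_apply, lp.coeFn_sub, Pi.sub_apply, hψ, smul_eq_mul]
    field_simp
    simp only [z]; push_cast; ring
  have hlim (s : ℝ) : Tendsto (fun n => ψ (s * ε n)) atTop (𝓝 φ) := by
    refine tendsto_lp_two_of_multipliers φ (fun n i => (z (s * ε n) i)⁻¹) (fun n i => hz1 _ i)
      (fun i => ?_) _ fun n i => rfl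
    have h0 : Tendsto (fun n => s * ε n) atTop (𝓝 0) := by
      simpa [ε] using (tendsto_one_div_add_atTop_nhds_zero_nat (𝕜 := ℝ)).const_mul s
    have hc : Continuous fun t => (z t i)⁻¹ :=
      Continuous.inv₀ (by fun_prop) fun t => hz t i
    simpa [z, Function.comp_def] using (hc.tendsto 0).comp h0
  have hconj (t : ℝ) : ⟪ψ (-t), φ⟫ = ⟪φ, ψ t⟫ := by
    rw [lp.inner_eq_tsum, lp.inner_eq_tsum]
    refine tsum_congr fun i => ?_
    have : (starRingEnd ℂ) (z (-t) i) = z t i := by simp [z]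
    simp only [hψ, RCLike.inner_apply, map_mul, map_inv₀, this]
    ring
  have hzero (t : ℝ) (ht : t ≠ 0) : ⟪ψ (-t), B (ψ t)⟫ = 0 := by
    have hI : (starRingEnd ℂ) (Complex.I * (-t : ℝ))⁻¹ = (Complex.I * t)⁻¹ := by simp
    rw [← hC1 _ _ _ _ (hA _ (neg_ne_zero.2 ht)) (hA _ ht), inner_smul_left, map_smul, inner_smul_right, hI, ← mul_sub,
      inner_sub_left, map_sub, inner_sub_right, hadj, hφ, inner_smul_right, hconj]
    ring
  refine tendsto_nhds_unique ((hlim (-1)).inner ((B.continuous.tendsto φ).comp (hlim 1))) ?_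
  have (n : ℕ) : ⟪ψ (-1 * ε n), B (ψ (1 * ε n))⟫ = 0 := by
    rw [neg_one_mul, one_mul]; exact hzero _ (hε n)
  simp only [Function.comp_def, this, tendsto_const_nhds]

/-- Proposition 2.9 ("transl"), eigenvalue part: let `α ∈ ℤ^d \ {0}`, let `A` be the
self-adjoint operator of multiplication by `α·β` on `ℓ²(ℤ^d)` (with maximal domain), and
let `U` be a unitary of class `C¹(A)` with commutator `B_U` such that
`ad_A(T^{−α}U) = T^{−α}B_U − |α|²T^{−α}U` is compact. Then `U` has at most finitely many
eigenvalues, each of finite multiplicity. -/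
theorem stmt7 (d : ℕ) (α : Fin d → ℤ) (hα : α ≠ 0)
    -- U a unitary operator of class C¹(A) with commutator BU, where
    -- A φ = (β ↦ (α·β)·φ(β)) with maximal domain {φ : (α·β)φ(β) ∈ ℓ²}
    (U BU : l2Zd d →L[ℂ] l2Zd d) (hU : U ∈ unitary (l2Zd d →L[ℂ] l2Zd d))
    (hC1 : ∀ (φ ψ : l2Zd d)
      (hφ : Memℓp (fun β : Fin d → ℤ => ((∑ j, α j * β j : ℤ) : ℂ) * φ β) 2)
      (hψ : Memℓp (fun β : Fin d → ℤ => ((∑ j, α j * β j : ℤ) : ℂ) * ψ β) 2),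
      ⟪(⟨fun β => ((∑ j, α j * β j : ℤ) : ℂ) * φ β, hφ⟩ : l2Zd d), U ψ⟫ -
        ⟪φ, U (⟨fun β => ((∑ j, α j * β j : ℤ) : ℂ) * ψ β, hψ⟩ : l2Zd d)⟫ =
      ⟪φ, BU ψ⟫)
    -- Tma is the translation T^{−α}
    (Tma : l2Zd d →L[ℂ] l2Zd d)
    (hTma : ∀ (φ : l2Zd d) (β : Fin d → ℤ), (Tma φ) β = φ (β + α))
    -- compactness of ad_A(T^{−α}U) = T^{−α}B_U − |α|²·T^{−α}U
    (hcomp : IsCompactOperator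
      ⇑(Tma * BU - ((∑ j, (α j) ^ 2 : ℤ) : ℂ) • (Tma * U))) :
    {c : ℂ | Module.End.HasEigenvalue (U : l2Zd d →ₗ[ℂ] l2Zd d) c}.Finite ∧
    ∀ c : ℂ, FiniteDimensional ℂ
      ↥(Module.End.eigenspace (U : l2Zd d →ₗ[ℂ] l2Zd d) c) := by
  have hUin (x y : l2Zd d) : ⟪U x, U y⟫ = ⟪x, y⟫ := by
    rw [← ContinuousLinearMap.adjoint_inner_right, ← ContinuousLinearMap.star_eq_adjoint,
      ← mul_apply_eq_comp, Unitary.star_mul_self_of_mem hU,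
      one_apply_eq_self]
  have hTin (x y : l2Zd d) : ⟪Tma x, Tma y⟫ = ⟪x, y⟫ := by
    rw [lp.inner_eq_tsum, lp.inner_eq_tsum]
    simp only [hTma]
    exact (Equiv.addRight α).tsum_eq fun β => ⟪x β, y β⟫
  have hC2 (φ ψ Aφ Aψ : l2Zd d) (hφ : ∀ β, Aφ β = ((∑ j, α j * β j : ℤ) : ℂ) * φ β)
      (hψ : ∀ β, Aψ β = ((∑ j, α j * β j : ℤ) : ℂ) * ψ β) :
      ⟪Aφ, U ψ⟫ - ⟪φ, U Aψ⟫ = ⟪φ, BU ψ⟫ := by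
    have m1 := funext hφ ▸ lp.memℓp Aφ
    have m2 := funext hψ ▸ lp.memℓp Aψ
    have e1 : Aφ = ⟨_, m1⟩ := lp.ext (funext hφ)
    have e2 : Aψ = ⟨_, m2⟩ := lp.ext (funext hψ)
    rw [← hC1 φ ψ m1 m2, ← e1, ← e2]
  refine finite_eigenvalues_of_no_orthonormal_eigenvectors _ hUin fun e he hev => ?_
  have hα2 : ((∑ j, (α j) ^ 2 : ℤ) : ℂ) ≠ 0 := by
    obtain ⟨j, hj⟩ := Function.ne_iff.1 hα
    have : 0 < ∑ j, (α j) ^ 2 :=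
      Finset.sum_pos' (fun i _ => sq_nonneg _) ⟨j, Finset.mem_univ j, sq_pos_of_ne_zero hj⟩
    exact_mod_cast this.ne'
  refine not_exists_orthonormal_inner_compact_eq (Tma * U) _ (fun x y => ?_) hcomp
    (neg_ne_zero.2 hα2) e he fun n => ?_
  · simp only [mul_apply_eq_comp, hTin, hUin]
  · obtain ⟨c, hc⟩ := hev n
    have hc' : U (e n) = c • e n := hc
    have hB := inner_commutator_eigenvector_eq_zero
      (fun β : Fin d → ℤ => ∑ j, α j * β j) U BU hUin hC2 hc'
    have hUB : ⟪U (e n), BU (e n)⟫ = 0 := by rw [hc', inner_smul_left, hB, mul_zero]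
    simp only [sub_apply, smul_apply,
      mul_apply_eq_comp, inner_sub_right, inner_smul_right, hTin, hUin, hUB,
      inner_self_eq_norm_sq_to_K, he.1 n]
    simp
end
end

section
/- Let A be a self-adjoint operator with domain D(A) on a Hilbert space H, let k ∈ ℕ, and let U be a unitary operator on H of class C^k(A). Let φ : ℝ → ℂ be a continuous 2π-periodic function with Fourier coefficients φ̂_m = (1/2π)∫₀^{2π} e^{−imθ}φ(θ)dθ, and assume that Σ_{m∈ℤ} |m|^k·|φ̂_m| < ∞ (so in particular (φ̂_m) is summable). Then the series Φ(U) := Σ_{m∈ℤ} φ̂_m U^m converges in operator norm, Φ(U) is of class C^k(A), and for each j ∈ {0, …, k} the j-th iterated commutator of Φ(U) with A equals the norm-convergent series Σ_{m∈ℤ} φ̂_m · ad_A^j(U^m), where ad_A^j(U^m) denotes the j-th iterated commutator of U^m with A. -/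
open scoped ComplexInnerProductSpace

/-- `C` is the commutator of `B` with the unbounded operator `A`, in the sense of forms on the
domain of `A`. -/
def IsFormCommutator {H : Type*} [NormedAddCommGroup H] [InnerProductSpace ℂ H]
    (A : H →ₗ.[ℂ] H) (B C : H →L[ℂ] H) : Prop :=
  ∀ φ ψ : A.domain, ⟪A φ, B (ψ : H)⟫ - ⟪(φ : H), B (A ψ)⟫ = ⟪(φ : H), C (ψ : H)⟫

namespace IsFormCommutator

variable {H : Type*} [NormedAddCommGroup H] [InnerProductSpace ℂ H]
  {A : H →ₗ.[ℂ] H} {B C B' C' : H →L[ℂ] H}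

theorem unique (hdense : Dense (A.domain : Set H)) (h : IsFormCommutator A B C)
    (h' : IsFormCommutator A B C') : C = C' := by
  refine ContinuousLinearMap.ext_on (s := (A.domain : Set H)) ?_ fun ψ hψ => ?_
  · rwa [Submodule.span_eq]
  · refine hdense.eq_of_inner_right (𝕜 := ℂ) fun φ hφ => ?_
    exact (h ⟨φ, hφ⟩ ⟨ψ, hψ⟩).symm.trans (h' ⟨φ, hφ⟩ ⟨ψ, hψ⟩)

theorem add (h : IsFormCommutator A B C) (h' : IsFormCommutator A B' C') :
    IsFormCommutator A (B + B') (C + C') := fun φ ψ => by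
  simp only [add_apply, inner_add_right, ← h φ ψ, ← h' φ ψ]
  ring

theorem smul (c : ℂ) (h : IsFormCommutator A B C) : IsFormCommutator A (c • B) (c • C) :=
  fun φ ψ => by
    simp only [smul_apply, inner_smul_right, ← h φ ψ]
    ring

theorem nsmul (n : ℕ) (h : IsFormCommutator A B C) : IsFormCommutator A (n • B) (n • C) := by
  simpa only [Nat.cast_smul_eq_nsmul] using h.smul (n : ℂ)

theorem zero : IsFormCommutator A 0 0 := fun φ ψ => by simp

theorem sum {ι : Type*} {s : Finset ι} {f g : ι → H →L[ℂ] H}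
    (h : ∀ i ∈ s, IsFormCommutator A (f i) (g i)) :
    IsFormCommutator A (∑ i ∈ s, f i) (∑ i ∈ s, g i) := by
  classical
  induction s using Finset.induction_on with
  | empty => simpa using zero
  | insert a s ha ih =>
    rw [Finset.sum_insert ha, Finset.sum_insert ha]
    exact (h a (Finset.mem_insert_self a s)).add
      (ih fun i hi => h i (Finset.mem_insert_of_mem hi))

theorem hasSum {ι : Type*} {f g : ι → H →L[ℂ] H} (h : ∀ i, IsFormCommutator A (f i) (g i))
    (hB : HasSum f B) (hC : HasSum g C) : IsFormCommutator A B C := fun φ ψ => by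
  have key : ∀ {F : ι → H →L[ℂ] H} {T : H →L[ℂ] H} (x y : H), HasSum F T →
      HasSum (fun i => ⟪x, F i y⟫) ⟪x, T y⟫ := fun {F T} x y hF =>
    (hF.mapL (ContinuousLinearMap.apply ℂ H y)).mapL (innerSL ℂ x)
  refine ((key (A φ) ψ hB).sub (key φ (A ψ) hB)).unique ?_
  simpa only [h _ φ ψ] using key (φ : H) (ψ : H) hC

variable [CompleteSpace H]

/-- An operator with a bounded commutator preserves the domain of the self-adjoint operator. -/
theorem exists_mem_domain (hdense : Dense (A.domain : Set H)) (hsa : A.adjoint = A)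
    (h : IsFormCommutator A B C) (ψ : A.domain) :
    ∃ hψ : B (ψ : H) ∈ A.domain, A ⟨B (ψ : H), hψ⟩ = B (A ψ) + C (ψ : H) := by
  have hw : ∀ x : A.domain, ⟪B (A ψ) + C (ψ : H), (x : H)⟫ = ⟪B (ψ : H), A x⟫ := fun x => by
    rw [← inner_conj_symm, ← inner_conj_symm (B (ψ : H)), inner_add_right, ← h x ψ]
    congr 1
    ring
  have key : ∃ hψ : B (ψ : H) ∈ A.adjoint.domain,
      A.adjoint ⟨B (ψ : H), hψ⟩ = B (A ψ) + C (ψ : H) :=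
    ⟨LinearPMap.mem_adjoint_domain_of_exists _ ⟨_, hw⟩,
      LinearPMap.adjoint_apply_eq hdense _ hw⟩
  rwa [hsa] at key

theorem mul (hdense : Dense (A.domain : Set H)) (hsa : A.adjoint = A)
    (h : IsFormCommutator A B C) (h' : IsFormCommutator A B' C') :
    IsFormCommutator A (B * B') (B * C' + C * B') := fun φ ψ => by
  obtain ⟨hψ, hA⟩ := h'.exists_mem_domain hdense hsa ψ
  have := h φ ⟨B' ψ, hψ⟩
  rw [hA, map_add, inner_add_right] at this
  simp only [mul_apply_eq_comp, add_apply, inner_add_right,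
    ← this]
  ring

/-- The Leibniz rule for chains of iterated commutators. -/
theorem chain_mul (hdense : Dense (A.domain : Set H)) (hsa : A.adjoint = A) {k : ℕ}
    {a b c : ℕ → H →L[ℂ] H}
    (ha : ∀ j < k, IsFormCommutator A (a j) (a (j + 1)))
    (hb : ∀ j < k, IsFormCommutator A (b j) (b (j + 1)))
    (hc : ∀ j < k, IsFormCommutator A (c j) (c (j + 1)))
    (hc0 : c 0 = a 0 * b 0) {j : ℕ} (hj : j ≤ k) :
    c j = ∑ p ∈ Finset.HasAntidiagonal.antidiagonal j, j.choose p.1 • (a p.1 * b p.2) := by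
  induction j with
  | zero => simpa using hc0
  | succ j ih =>
    refine (hc j hj).unique hdense ?_
    rw [ih (Nat.le_of_succ_le hj),
      Finset.sum_antidiagonal_choose_succ_nsmul (fun x y => a x * b y) j,
      ← Finset.sum_add_distrib]
    refine sum fun p hp => ?_
    have hp' := Finset.HasAntidiagonal.mem_antidiagonal.mp hp
    rw [Nat.choose_symm_of_eq_add (hp'.symm.trans (add_comm _ _)), ← nsmul_add]
    exact ((ha p.1 (by omega)).mul hdense hsa (hb p.2 (by omega))).nsmul _

end IsFormCommutator

/-- If `a n` is obtained by iterating the Leibniz rule with `b`, where `‖b 0‖ ≤ 1`, then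
`‖a n j‖` grows at most like `n ^ j`. -/
theorem exists_norm_le_of_leibniz {R : Type*} [NormedRing R] {k : ℕ} {a : ℕ → ℕ → R}
    {b : ℕ → R} (ha0 : ∀ n, ‖a n 0‖ ≤ 1) (hb0 : ‖b 0‖ ≤ 1)
    (hmul : ∀ n, ∀ j ≤ k, a (n + 1) j =
      ∑ p ∈ Finset.HasAntidiagonal.antidiagonal j, j.choose p.1 • (b p.1 * a n p.2)) :
    ∃ C : ℝ, 0 ≤ C ∧ ∀ j ≤ k, ∀ n : ℕ, ‖a n j‖ ≤ C * (1 + n) ^ j := by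
  suffices h : ∀ l ≤ k, ∃ C : ℝ, 0 ≤ C ∧ ∀ j ≤ l, ∀ n : ℕ, ‖a n j‖ ≤ C * (1 + n) ^ j from
    h k le_rfl
  intro l
  induction l with
  | zero =>
    refine fun _ => ⟨1, zero_le_one, fun j hj n => ?_⟩
    obtain rfl := Nat.le_zero.mp hj
    simpa using ha0 n
  | succ l ih =>
    intro hl
    obtain ⟨C, hC, hbd⟩ := ih (Nat.le_of_succ_le hl)
    set K : ℝ := ∑ p ∈ Finset.HasAntidiagonal.antidiagonal l, (l + 1).choose (p.1 + 1) * (‖b (p.1 + 1)‖ * C)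
      with hK
    have hK0 : 0 ≤ K := Finset.sum_nonneg fun p _ => by positivity
    have hstep : ∀ n : ℕ, ‖a (n + 1) (l + 1)‖ ≤ ‖a n (l + 1)‖ + K * (1 + n) ^ l := by
      intro n
      rw [hmul n (l + 1) hl, Finset.Nat.sum_antidiagonal_succ, hK, Finset.sum_mul]
      refine (norm_add_le _ _).trans (add_le_add ?_ (norm_sum_le_of_le _ fun p hp => ?_))
      · rw [Nat.choose_zero_right, one_smul]
        exact (norm_mul_le _ _).trans (mul_le_of_le_one_left (norm_nonneg _) hb0)
      · have hp' : p.2 ≤ l :=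
          (Nat.le_add_left _ _).trans (Finset.HasAntidiagonal.mem_antidiagonal.mp hp).le
        have hpow : ((1 : ℝ) + n) ^ p.2 ≤ (1 + n) ^ l :=
          pow_le_pow_right₀ (by linarith [Nat.cast_nonneg (α := ℝ) n]) hp'
        calc ‖(l + 1).choose (p.1 + 1) • (b (p.1 + 1) * a n p.2)‖
            ≤ (l + 1).choose (p.1 + 1) * ‖b (p.1 + 1) * a n p.2‖ := norm_nsmul_le
          _ ≤ (l + 1).choose (p.1 + 1) * (‖b (p.1 + 1)‖ * (C * (1 + n) ^ l)) := by
            gcongr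
            refine (norm_mul_le _ _).trans ?_
            gcongr
            exact (hbd p.2 hp' n).trans (by gcongr)
          _ = _ := by ring
    have htop : ∀ n : ℕ, ‖a n (l + 1)‖ ≤ (‖a 0 (l + 1)‖ + K) * (1 + n) ^ (l + 1) := by
      intro n
      induction n with
      | zero => simpa using hK0
      | succ n ihn =>
        calc ‖a (n + 1) (l + 1)‖
            ≤ (‖a 0 (l + 1)‖ + K) * (1 + n) ^ (l + 1) + K * (1 + n) ^ l :=
              (hstep n).trans (by gcongr)
          _ ≤ (‖a 0 (l + 1)‖ + K) * (1 + n) ^ (l + 1) +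
                (‖a 0 (l + 1)‖ + K) * (1 + n) ^ l := by
              gcongr
              exact le_add_of_nonneg_left (norm_nonneg _)
          _ = (‖a 0 (l + 1)‖ + K) * ((1 + n) ^ l * (1 + (n + 1 : ℕ))) := by
              push_cast
              ring
          _ ≤ (‖a 0 (l + 1)‖ + K) * ((1 + (n + 1 : ℕ)) ^ l * (1 + (n + 1 : ℕ))) := by
              gcongr
              exact Nat.le_succ n
          _ = _ := by rw [pow_succ]
    refine ⟨max C (‖a 0 (l + 1)‖ + K), hC.trans (le_max_left _ _), fun j hj n => ?_⟩
    rcases Nat.le_succ_iff.mp hj with hj | rfl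
    · exact (hbd j hj n).trans (by gcongr; exact le_max_left _ _)
    · exact (htop n).trans (by gcongr; exact le_max_right _ _)

/-- The iterated commutators of the powers of a unitary operator grow polynomially. -/
theorem exists_norm_iterated_commutator_zpow_le {H : Type*} [NormedAddCommGroup H]
    [InnerProductSpace ℂ H] [CompleteSpace H] {A : H →ₗ.[ℂ] H}
    (hdense : Dense (A.domain : Set H)) (hsa : A.adjoint = A) {k : ℕ}
    {U : unitary (H →L[ℂ] H)} {adU : ℤ → ℕ → (H →L[ℂ] H)}
    (hadU0 : ∀ m : ℤ, adU m 0 = ((U ^ m : unitary (H →L[ℂ] H)) : H →L[ℂ] H))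
    (hadU : ∀ m : ℤ, ∀ j < k, IsFormCommutator A (adU m j) (adU m (j + 1))) :
    ∃ C : ℝ, 0 ≤ C ∧ ∀ j ≤ k, ∀ m : ℤ, ‖adU m j‖ ≤ C * (1 + |(m : ℝ)|) ^ j := by
  have hnorm : ∀ m : ℤ, ‖adU m 0‖ ≤ 1 := fun m => by
    rw [hadU0]
    exact ContinuousLinearMap.opNorm_le_bound _ zero_le_one fun x => by
      rw [ContinuousLinearMap.norm_map_of_mem_unitary (U ^ m).2, one_mul]
  have hleib : ∀ m n : ℤ, ∀ j ≤ k, adU (m + n) j =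
      ∑ p ∈ Finset.HasAntidiagonal.antidiagonal j, j.choose p.1 • (adU m p.1 * adU n p.2) := fun m n j hj =>
    IsFormCommutator.chain_mul hdense hsa (hadU m) (hadU n) (hadU (m + n))
      (by rw [hadU0, hadU0, hadU0, zpow_add]; rfl) hj
  obtain ⟨C, hC, hpos⟩ := exists_norm_le_of_leibniz (k := k) (a := fun n => adU n) (b := adU 1)
    (fun n => hnorm n) (hnorm 1) fun n j hj => by
      rw [← hleib 1 n j hj, add_comm (1 : ℤ)]
      push_cast
      rfl
  obtain ⟨D, hD, hneg⟩ := exists_norm_le_of_leibniz (k := k) (a := fun n => adU (-n))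
    (b := adU (-1)) (fun n => hnorm (-n)) (hnorm (-1)) fun n j hj => by
      rw [← hleib (-1) (-n) j hj, ← neg_add, add_comm (1 : ℤ)]
      push_cast
      rfl
  refine ⟨max C D, hC.trans (le_max_left _ _), fun j hj m => ?_⟩
  obtain ⟨n, rfl | rfl⟩ := m.eq_nat_or_neg
  · refine (hpos j hj n).trans ?_
    simp only [Int.cast_natCast, Nat.abs_cast]
    gcongr
    exact le_max_left _ _
  · refine (hneg j hj n).trans ?_
    simp only [Int.cast_neg, Int.cast_natCast, abs_neg, Nat.abs_cast]
    gcongr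
    exact le_max_right _ _

/-- Proposition 6.10 ("10"): if `U` is unitary of class `C^k(A)` and `φ` is a continuous
`2π`-periodic function whose Fourier coefficients satisfy `Σ_m |m|^k |φ̂_m| < ∞`, then
`Φ(U) = Σ_m φ̂_m U^m` converges in norm, is of class `C^k(A)`, and for `0 ≤ j ≤ k` its
`j`-th iterated commutator with `A` is the norm-convergent series `Σ_m φ̂_m ad_A^j(U^m)`.
The class `C^k(A)` is encoded through chains of iterated commutators: `adU m` is the
chain of iterated commutators of `U^m`. -/
theorem stmt16
    {H : Type*} [NormedAddCommGroup H] [InnerProductSpace ℂ H] [CompleteSpace H]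
    -- A self-adjoint (densely defined) operator on H
    (A : H →ₗ.[ℂ] H) (hdense : Dense (A.domain : Set H)) (hsa : A.adjoint = A)
    (k : ℕ)
    -- U a unitary operator; for each m : ℤ, adU m is the chain of iterated commutators
    -- of U^m with A, so that U (i.e. m = 1) is of class C^k(A)
    (U : unitary (H →L[ℂ] H)) (adU : ℤ → ℕ → (H →L[ℂ] H))
    (hadU0 : ∀ m : ℤ, adU m 0 = ((U ^ m : unitary (H →L[ℂ] H)) : H →L[ℂ] H))
    (hadU : ∀ (m : ℤ) (j : ℕ), j < k → ∀ φ ψ : A.domain,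
      ⟪A φ, adU m j (ψ : H)⟫ - ⟪(φ : H), adU m j (A ψ)⟫ =
        ⟪(φ : H), adU m (j + 1) (ψ : H)⟫)
    -- φf a continuous 2π-periodic function with Fourier coefficients fc
    (φf : ℝ → ℂ) (hcont : Continuous φf) (hper : ∀ θ : ℝ, φf (θ + 2 * Real.pi) = φf θ)
    (fc : ℤ → ℂ)
    (hfc : ∀ m : ℤ, fc m = (2 * (Real.pi : ℂ))⁻¹ *
      ∫ θ in (0 : ℝ)..(2 * Real.pi), Complex.exp (-(m : ℂ) * Complex.I * (θ : ℂ)) * φf θ)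
    -- summability assumptions
    (hsum : Summable fun m : ℤ => (|m| : ℝ) ^ k * ‖fc m‖)
    (hsum0 : Summable fun m : ℤ => ‖fc m‖) :
    ∃ Φ : H →L[ℂ] H,
      -- Φ(U) = Σ_m φ̂_m U^m converges in operator norm
      HasSum (fun m : ℤ => fc m • ((U ^ m : unitary (H →L[ℂ] H)) : H →L[ℂ] H)) Φ ∧
      -- Φ(U) is of class C^k(A), with iterated commutators Cs j, ...
      ∃ Cs : ℕ → (H →L[ℂ] H), Cs 0 = Φ ∧
        (∀ j : ℕ, j < k → ∀ φ ψ : A.domain,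
          ⟪A φ, Cs j (ψ : H)⟫ - ⟪(φ : H), Cs j (A ψ)⟫ =
            ⟪(φ : H), Cs (j + 1) (ψ : H)⟫) ∧
        -- ... each given by the norm-convergent series Σ_m φ̂_m ad_A^j(U^m)
        (∀ j : ℕ, j ≤ k → HasSum (fun m : ℤ => fc m • adU m j) (Cs j)) := by
  obtain ⟨C, hC, hbd⟩ := exists_norm_iterated_commutator_zpow_le hdense hsa hadU0 hadU
  have hsummable : ∀ j ≤ k, Summable fun m : ℤ => fc m • adU m j := by
    intro j hj
    refine Summable.of_norm_bounded ((hsum0.add hsum).mul_left (C * 2 ^ (k - 1))) fun m => ?_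
    have hpow : (1 + |(m : ℝ)|) ^ j ≤ 2 ^ (k - 1) * (1 + |(m : ℝ)| ^ k) :=
      (pow_le_pow_right₀ (by linarith [abs_nonneg (m : ℝ)]) hj).trans
        (by simpa using add_pow_le zero_le_one (abs_nonneg (m : ℝ)) k)
    calc ‖fc m • adU m j‖ ≤ ‖fc m‖ * ‖adU m j‖ := norm_smul_le _ _
      _ ≤ ‖fc m‖ * (C * (2 ^ (k - 1) * (1 + |(m : ℝ)| ^ k))) := by
        gcongr
        exact (hbd j hj m).trans (by gcongr)
      _ = C * 2 ^ (k - 1) * (‖fc m‖ + |(m : ℝ)| ^ k * ‖fc m‖) := by ring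
  refine ⟨∑' m : ℤ, fc m • adU m 0, ?_, fun j => ∑' m : ℤ, fc m • adU m j, rfl,
    fun j hj => ?_, fun j hj => (hsummable j hj).hasSum⟩
  · simpa only [hadU0] using (hsummable 0 (Nat.zero_le k)).hasSum
  · exact IsFormCommutator.hasSum (fun m => (show IsFormCommutator A _ _ from
      hadU m j hj).smul (fc m)) (hsummable j hj.le).hasSum (hsummable (j + 1) hj).hasSum
end
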